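/- arXiv:2107.00134 — 13 statements merged into one kernel-verified Lean document; each statement's English description precedes it below -/
import Mathlib

section
/- Let G and H be simple graphs on the vertex set N = {1,…,n} and let Σ ∈ M(G,H). Suppose V and W are disjoint subsets of N with V ∪ W = N such that no edge belonging to both E_G and E_H joins a vertex of V to a vertex of W. Then Σ_{vw} = 0 for all v ∈ V and w ∈ W, i.e., Σ is block-diagonal with blocks indexed by V and W. -/
open scoped Matrix MatrixOrder in
/-- A diagonal sign matrix `D` with `d i * d j = 1` wherever `S i j * S⁻¹ j i ≠ 0`
commutes with the positive definite matrix `S`. -/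
theorem Matrix.PosDef.diagonal_mul_mul_diagonal_eq {m : Type*} [Fintype m] [DecidableEq m]
    {S : Matrix m m ℝ} (hpd : S.PosDef) (d : m → ℝ) (hd : ∀ i, d i * d i = 1)
    (hSK : ∀ i j, d i * d j = 1 ∨ S i j * S⁻¹ j i = 0) :
    Matrix.diagonal d * S * Matrix.diagonal d = S := by
  obtain ⟨P, hP⟩ := CStarAlgebra.nonneg_iff_eq_star_mul_self.mp hpd.inv.posSemidef.nonneg
  have hKS : S⁻¹ * S = 1 := Matrix.nonsing_inv_mul S hpd.det_pos.ne'.isUnit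
  have hS : S.IsSymm := by simpa using hpd.isHermitian
  have htr : (Matrix.diagonal d * S * Matrix.diagonal d * S⁻¹).trace = (S * S⁻¹).trace := by
    simp only [Matrix.trace, Matrix.diag, Matrix.mul_apply (N := S⁻¹), Matrix.mul_diagonal,
      Matrix.diagonal_mul]
    refine Finset.sum_congr rfl fun i _ => Finset.sum_congr rfl fun j _ => ?_
    rcases hSK i j with h | h
    · linear_combination S i j * S⁻¹ j i * h
    · linear_combination (d i * d j - 1) * h
  set K := S⁻¹
  set D := Matrix.diagonal d with hD
  have hDD : D * D = 1 := by simp [hD, Matrix.diagonal_mul_diagonal, hd]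
  have hDt : Dᵀ = D := Matrix.diagonal_transpose d
  have hSK1 : S * K = 1 := mul_eq_one_comm.mp hKS
  rw [Matrix.star_eq_conjTranspose, Matrix.conjTranspose_eq_transpose_of_trivial] at hP
  set E := D * S * D - S with hE
  have hEt : Eᵀ = E := by
    simp [hE, Matrix.transpose_mul, hDt, hS.eq, Matrix.mul_assoc]
  have hDSDK : D * S * D * (D * K * D) = 1 := by
    calc _ = D * (S * ((D * D) * K)) * D := by noncomm_ring
      _ = 1 := by rw [hDD, one_mul, hSK1, mul_one, hDD]
  have hDKDS : (D * K * D) * (D * S * D) = 1 := mul_eq_one_comm.mp hDSDK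
  have hprod : E * (D * K * D) * E * K = D * S * D * K + S * (D * K * D) - 2 := by
    calc _ = (D * S * D * (D * K * D)) * (D * S * D) * K
          - (D * S * D * (D * K * D)) * (S * K)
          - S * ((D * K * D) * (D * S * D)) * K + S * (D * K * D) * (S * K) := by
            rw [hE]; noncomm_ring
      _ = _ := by
        rw [hDSDK, hDKDS, mul_one, hSK1, ← one_add_one_eq_two]
        noncomm_ring
  have htr' : (S * (D * K * D)).trace = (S * K).trace := by
    rw [← htr, ← Matrix.mul_assoc, Matrix.trace_mul_comm]
    simp only [Matrix.mul_assoc]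
  have hzero : (E * (D * K * D) * E * K).trace = 0 := by
    rw [hprod, Matrix.trace_sub, Matrix.trace_add, htr, htr', hSK1,
      ← one_add_one_eq_two, Matrix.trace_add]
    ring
  have hX : P * E * D * Pᵀ = 0 := by
    rw [← Matrix.trace_mul_conjTranspose_self_eq_zero_iff,
      Matrix.conjTranspose_eq_transpose_of_trivial, ← hzero]
    simp only [Matrix.transpose_mul, Matrix.transpose_transpose, hEt, hDt, hP]
    rw [← Matrix.mul_assoc _ Pᵀ P, Matrix.trace_mul_comm _ P]
    simp only [Matrix.mul_assoc]
  have hE0 : E = 0 := by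
    have h : K * E * (D * K) = 0 := by
      calc _ = Pᵀ * (P * E * D * Pᵀ) * P := by rw [hP]; simp only [Matrix.mul_assoc]
        _ = 0 := by rw [hX]; simp
    calc E = (S * K) * E * (D * (K * S) * D) := by simp [hSK1, hKS, hDD]
      _ = S * (K * E * (D * K)) * S * D := by simp only [Matrix.mul_assoc]
      _ = 0 := by rw [h]; simp
  exact sub_eq_zero.mp hE0

/-- **Decomposition theorem (block structure).** If `Σ` is in the Gaussian double
Markovian model `M(G,H)` and `V, W` partition the vertex set such that no common
edge of `G` and `H` joins `V` to `W`, then `Σ` vanishes on the `V × W` block. -/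
theorem doubleMarkov_block_diagonal {n : ℕ} (G H : SimpleGraph (Fin n))
    (S : Matrix (Fin n) (Fin n) ℝ) (hpd : S.PosDef)
    (hG : ∀ i j : Fin n, i ≠ j → ¬ G.Adj i j → S⁻¹ i j = 0)
    (hH : ∀ i j : Fin n, i ≠ j → ¬ H.Adj i j → S i j = 0)
    (V W : Set (Fin n)) (hdisj : Disjoint V W) (hcover : V ∪ W = Set.univ)
    (hedge : ∀ v ∈ V, ∀ w ∈ W, ¬ (G.Adj v w ∧ H.Adj v w)) :
    ∀ v ∈ V, ∀ w ∈ W, S v w = 0 := by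
  classical
  intro v hv w hw
  have hcase : ∀ i, i ∉ V → i ∈ W := fun i hi => by
    have h : i ∈ V ∪ W := hcover ▸ Set.mem_univ i
    exact h.resolve_left hi
  have hcross : ∀ i ∈ V, ∀ j ∈ W, S i j = 0 ∨ S⁻¹ i j = 0 := fun i hi j hj => by
    have hij : i ≠ j := fun h => Set.disjoint_left.mp hdisj hi (h ▸ hj)
    by_cases hGij : G.Adj i j
    · exact .inl (hH i j hij fun h => hedge i hi j hj ⟨hGij, h⟩)
    · exact .inr (hG i j hij hGij)
  have hS (i j) : S i j = S j i := by simpa using hpd.isHermitian.apply j i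
  have hK (i j) : S⁻¹ i j = S⁻¹ j i := by simpa using hpd.inv.isHermitian.apply j i
  have key := hpd.diagonal_mul_mul_diagonal_eq (fun i => if i ∈ V then 1 else -1)
    (fun i => by split_ifs <;> norm_num) fun i j => by
      by_cases hi : i ∈ V <;> by_cases hj : j ∈ V
      · simp [hi, hj]
      · rw [hK j i]
        exact .inr (mul_eq_zero.mpr (hcross i hi j (hcase j hj)))
      · rw [hS i j]
        exact .inr (mul_eq_zero.mpr (hcross j hj i (hcase i hi)))
      · simp [hi, hj]
  have h := congrFun (congrFun key v) w
  have hwV : w ∉ V := fun h => Set.disjoint_left.mp hdisj h hw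
  simp only [Matrix.mul_diagonal, Matrix.diagonal_mul, hv, hwV, if_true, if_false] at h
  linarith
end

section
/- Let G and H be simple graphs on the vertex set N = {1,…,n}. Then M₁(G,H) = {𝟙_n} (the correlation model consists only of the identity matrix) if and only if E_G ∩ E_H = ∅. -/
namespace Matrix

variable {ι : Type*} [DecidableEq ι]

/-- The correlation matrix whose only off-diagonal entries are `1 / 2` at `(i, j)` and `(j, i)`. -/
noncomputable def edgeCorrelation (i j : ι) : Matrix ι ι ℝ :=
  1 + (1 / 2 : ℝ) • (single i j 1 + single j i 1)

theorem edgeCorrelation_apply_self {i j : ι} (hij : i ≠ j) (k : ι) :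
    edgeCorrelation i j k k = 1 := by
  simp only [edgeCorrelation, add_apply, smul_apply, single_apply, one_apply, smul_eq_mul]
  grind

theorem edgeCorrelation_apply_eq_zero {i j k l : ι} (hkl : k ≠ l) (hne : s(i, j) ≠ s(k, l)) :
    edgeCorrelation i j k l = 0 := by
  rw [ne_eq, Sym2.eq_iff] at hne
  simp only [edgeCorrelation, add_apply, smul_apply, single_apply, one_apply, smul_eq_mul]
  grind

variable [Fintype ι]

/-- If `S` and `S⁻¹` have disjoint off-diagonal supports and `S` has unit diagonal, then `S⁻¹` has
the trace of the identity. -/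
theorem trace_inv_eq_card_of_disjoint_support {S : Matrix ι ι ℝ} (hS : IsUnit S)
    (hdiag : ∀ i, S i i = 1) (hoff : ∀ i j, i ≠ j → S i j = 0 ∨ S⁻¹ j i = 0) :
    S⁻¹.trace = Fintype.card ι := by
  have hmul : S * S⁻¹ = 1 := mul_nonsing_inv S ((isUnit_iff_isUnit_det S).mp hS)
  rw [← trace_one (R := ℝ), ← hmul, trace, trace]
  refine Finset.sum_congr rfl fun i _ => ?_
  rw [diag_apply, diag_apply, mul_apply, Finset.sum_eq_single i]
  · rw [hdiag, one_mul]
  · intro j _ hj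
    exact mul_eq_zero.mpr (hoff i j hj.symm)
  · simp

/-- A positive definite matrix for which both it and its inverse have the trace of the identity
is the identity. -/
theorem PosDef.eq_one_of_trace_eq_card {S : Matrix ι ι ℝ} (hS : S.PosDef)
    (htr : S.trace = Fintype.card ι) (htr_inv : S⁻¹.trace = Fintype.card ι) : S = 1 := by
  have hdet := (isUnit_iff_isUnit_det S).mp hS.isUnit
  have hmul : S * S⁻¹ = 1 := mul_nonsing_inv S hdet
  have hmul' : S⁻¹ * S = 1 := nonsing_inv_mul S hdet
  have hherm : (S - 1)ᴴ = S - 1 := (hS.isHermitian.sub isHermitian_one).eq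
  have hexp : (S - 1)ᴴ * S⁻¹ * (S - 1) = S - 1 - (1 - S⁻¹) := by
    rw [hherm, sub_mul, hmul, one_mul, mul_sub, sub_mul, hmul', mul_one, one_mul]
  have hpsd := hS.inv.posSemidef.conjTranspose_mul_mul_same (S - 1)
  have hzero : S - 1 - (1 - S⁻¹) = 0 := by
    rw [hexp] at hpsd
    rw [← hpsd.trace_eq_zero_iff]
    simp [trace_sub, htr, htr_inv]
  have hsq : (S - 1)ᴴ * (S - 1) = 0 := by
    have := congrArg (S * ·) hzero
    simp only [mul_sub, hmul, mul_one, mul_zero] at this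
    rw [hherm, ← this]
    noncomm_ring
  exact sub_eq_zero.mp (conjTranspose_mul_self_eq_zero.mp hsq)

theorem inv_edgeCorrelation {i j : ι} (hij : i ≠ j) :
    (edgeCorrelation i j)⁻¹ = 1 + (1 / 3 : ℝ) • (single i i 1 + single j j 1)
      - (2 / 3 : ℝ) • (single i j 1 + single j i 1) := by
  apply inv_eq_right_inv
  have hji := hij.symm
  simp only [edgeCorrelation, add_mul, mul_add, mul_sub, smul_add, smul_mul_assoc,
    mul_smul_comm, one_mul, mul_one, single_mul_single_same, ne_eq, hij, hji, not_false_eq_true,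
    single_mul_single_of_ne, smul_zero]
  module

theorem posDef_edgeCorrelation {i j : ι} (hij : i ≠ j) : (edgeCorrelation i j).PosDef := by
  let v : ι → ℝ := Pi.single i 1 + Pi.single j 1
  have hsum : edgeCorrelation i j =
      diagonal (fun k => if k = i ∨ k = j then (1 / 2 : ℝ) else 1) +
        (1 / 2 : ℝ) • vecMulVec v (star v) := by
    ext k l
    simp only [edgeCorrelation, v, add_apply, smul_apply, one_apply, diagonal_apply, single_apply,
      vecMulVec_apply, star_trivial, Pi.add_apply, Pi.single_apply, smul_eq_mul]
    grind
  rw [hsum]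
  refine (PosDef.diagonal fun k => ?_).add_posSemidef
    ((posSemidef_vecMulVec_self_star v).smul (by norm_num))
  split_ifs <;> norm_num

theorem inv_edgeCorrelation_apply_eq_zero {i j k l : ι} (hij : i ≠ j) (hkl : k ≠ l)
    (hne : s(i, j) ≠ s(k, l)) : (edgeCorrelation i j)⁻¹ k l = 0 := by
  rw [ne_eq, Sym2.eq_iff] at hne
  simp only [inv_edgeCorrelation hij, add_apply, sub_apply, smul_apply, single_apply, one_apply,
    smul_eq_mul]
  grind

end Matrix

open Matrix in
/-- The correlation model `M₁(G,H)` of the Gaussian double Markovian model consists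
only of the identity matrix if and only if the edge sets of `G` and `H` are disjoint. -/
theorem doubleMarkov_correlation_trivial_iff {n : ℕ} (G H : SimpleGraph (Fin n)) :
    {S : Matrix (Fin n) (Fin n) ℝ | S.PosDef ∧ (∀ i, S i i = 1) ∧
        (∀ i j : Fin n, i ≠ j → ¬ G.Adj i j → S⁻¹ i j = 0) ∧
        (∀ i j : Fin n, i ≠ j → ¬ H.Adj i j → S i j = 0)} = {1} ↔
      G.edgeSet ∩ H.edgeSet = ∅ := by
  constructor
  · intro hmodel
    by_contra hne
    obtain ⟨e, heG, heH⟩ := Set.nonempty_iff_ne_empty.mpr hne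
    induction e with | _ i j
    have hij : i ≠ j := G.ne_of_adj heG
    have hmem : edgeCorrelation i j ∈ ({1} : Set (Matrix (Fin n) (Fin n) ℝ)) := by
      rw [← hmodel]
      refine ⟨posDef_edgeCorrelation hij, edgeCorrelation_apply_self hij,
        fun k l hkl hnot => inv_edgeCorrelation_apply_eq_zero hij hkl fun heq => ?_,
        fun k l hkl hnot => edgeCorrelation_apply_eq_zero hkl fun heq => ?_⟩
      · exact hnot (heq ▸ heG : s(k, l) ∈ G.edgeSet)
      · exact hnot (heq ▸ heH : s(k, l) ∈ H.edgeSet)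
    have hentry := congrFun (congrFun (Set.mem_singleton_iff.mp hmem) i) j
    simp [edgeCorrelation, hij, hij.symm] at hentry
  · intro hdisj
    refine Set.eq_singleton_iff_unique_mem.mpr ⟨⟨PosDef.one, by simp, ?_, ?_⟩, ?_⟩
    · intro i j hij _
      rw [inv_one, one_apply_ne hij]
    · intro i j hij _
      exact one_apply_ne hij
    · rintro S ⟨hpd, hdiag, hG, hH⟩
      refine hpd.eq_one_of_trace_eq_card (by simp [trace, hdiag])
        (trace_inv_eq_card_of_disjoint_support hpd.isUnit hdiag fun i j hij => ?_)
      by_cases hadj : H.Adj i j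
      · refine Or.inr (hG j i hij.symm fun hadj' => ?_)
        have hmem : s(i, j) ∈ G.edgeSet ∩ H.edgeSet := ⟨hadj'.symm, hadj⟩
        simp [hdisj] at hmem
      · exact Or.inl (hH i j hij hadj)
end

section
/- Let Σ be a real symmetric positive definite n×n matrix with the property that for every pair of indices i ≠ j, at least one of Σ_{ij} = 0 or (Σ⁻¹)_{ij} = 0 holds. Then Σ is a diagonal matrix, i.e., Σ_{ij} = 0 for all i ≠ j. -/
/-- If `Σ` is a real symmetric positive definite matrix such that for every pair of
distinct indices at least one of `Σ_{ij}` and `(Σ⁻¹)_{ij}` vanishes, then `Σ` is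
diagonal. -/
theorem posDef_offDiag_or_inv_offDiag_eq_zero_imp_diagonal {n : ℕ}
    (S : Matrix (Fin n) (Fin n) ℝ) (hpd : S.PosDef)
    (h : ∀ i j : Fin n, i ≠ j → S i j = 0 ∨ S⁻¹ i j = 0) :
    ∀ i j : Fin n, i ≠ j → S i j = 0 := by
  intro j i hji
  have hdet : IsUnit S.det := (Matrix.isUnit_iff_isUnit_det S).mp hpd.isUnit
  have hSK : S * S⁻¹ = 1 := Matrix.mul_nonsing_inv S hdet
  have hsym : ∀ a b, S a b = S b a := fun a b => by simpa using hpd.isHermitian.apply b a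
  have hdiag : S i i * S⁻¹ i i = 1 := by
    have hii := congrFun (congrFun hSK i) i
    rw [Matrix.mul_apply, Matrix.one_apply_eq, Finset.sum_eq_single i] at hii
    · exact hii
    · intro b _ hb
      rcases h b i hb with h0 | h0
      · rw [hsym i b, h0, zero_mul]
      · rw [h0, mul_zero]
    · simp
  -- The quadratic form of `S` vanishes at `x`, so `x = 0`.
  let x : Fin n → ℝ := fun a => S⁻¹ a i - S⁻¹ i i * (Pi.single i 1 : Fin n → ℝ) a
  have hSx : ∀ a, S.mulVec x a = (1 : Matrix (Fin n) (Fin n) ℝ) a i - S⁻¹ i i * S a i := by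
    intro a
    rw [← hSK, Matrix.mul_apply]
    simp [x, Matrix.mulVec, dotProduct, mul_sub, Finset.sum_sub_distrib, Pi.single_apply,
      mul_comm]
  have hx : x = 0 := by
    by_contra hne
    have hpos := hpd.dotProduct_mulVec_pos hne
    refine hpos.ne' (Finset.sum_eq_zero fun a _ => ?_)
    rw [hSx]
    by_cases ha : a = i
    · subst ha
      simp [mul_comm (S⁻¹ a a), hdiag]
    · rcases h a i ha with h0 | h0 <;> simp [x, ha, h0]
  have hj := hSx j
  rw [hx, Matrix.mulVec_zero, Matrix.one_apply_ne hji, Pi.zero_apply, zero_sub, eq_comm,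
    neg_eq_zero] at hj
  exact (mul_eq_zero.mp hj).resolve_left (right_ne_zero_of_mul_eq_one hdiag)
end

section
/- Let H be a simple graph on N = {1,…,n} and let Σ = (σ_{ij}) be a real symmetric n×n matrix with σ_{ij} = 0 whenever i ≠ j and {i,j} ∉ E_H. Then for any two distinct vertices k, l ∈ N: (−1)^{k+l}·det(Σ_{N∖{k}, N∖{l}}) equals the sum, over all paths p in H from k to l, of (−1)^{|V(p)|−1} · det(Σ_{N∖V(p), N∖V(p)}) · σ_p. Here Σ_{A,B} denotes the submatrix with rows indexed by A and columns by B (both taken in increasing order), and the determinant of the empty matrix is 1. -/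
namespace Matrix

variable {V R : Type*} [DecidableEq V] [CommRing R]

/-- The matrix obtained from `A` by replacing the rows indexed by `U` by rows of the
identity matrix. -/
def replaceRowsByOne (A : Matrix V V R) (U : Finset V) : Matrix V V R :=
  of fun i j => if i ∈ U then (1 : Matrix V V R) i j else A i j

theorem replaceRowsByOne_empty (A : Matrix V V R) : A.replaceRowsByOne ∅ = A := by
  ext i j
  simp [replaceRowsByOne]

theorem replaceRowsByOne_updateRow_single (A : Matrix V V R) (U : Finset V) (i : V) :
    (A.replaceRowsByOne U).updateRow i (Pi.single i 1) = A.replaceRowsByOne (insert i U) := by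
  ext a b
  by_cases h : a = i
  · subst h
    simp [replaceRowsByOne, one_apply, Pi.single_apply, eq_comm]
  · simp [replaceRowsByOne, h]

variable [Fintype V]

theorem det_replaceRowsByOne (A : Matrix V V R) (U : Finset V) :
    (A.replaceRowsByOne U).det = (A.toSquareBlockProp (· ∉ U)).det := by
  rw [twoBlockTriangular_det' (A.replaceRowsByOne U) (· ∈ U)]
  · have h₁ : (A.replaceRowsByOne U).toSquareBlockProp (· ∈ U) = 1 := by
      ext i j
      have hi : (i : V) ∈ U := i.2
      simp [replaceRowsByOne, toSquareBlockProp, hi, one_apply]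
    have h₂ : (A.replaceRowsByOne U).toSquareBlockProp (fun i => ¬ i ∈ U) =
        A.toSquareBlockProp (· ∉ U) := by
      ext i j
      have hi : (i : V) ∉ U := i.2
      simp [replaceRowsByOne, toSquareBlockProp, hi]
    rw [h₁, h₂, @det_one _ _ (Subtype.fintype (· ∈ U)), one_mul]
  · intro i hi j hj
    have hij : i ≠ j := fun h => hj (h ▸ hi)
    simp [replaceRowsByOne, hi, hij]

theorem det_submatrix_orderEmbOfFin_compl [LinearOrder V] (A : Matrix V V R) (U : Finset V)
    {m : ℕ} (h : Uᶜ.card = m) :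
    (A.submatrix (Uᶜ.orderEmbOfFin h) (Uᶜ.orderEmbOfFin h)).det =
      (A.replaceRowsByOne U).det := by
  rw [det_replaceRowsByOne]
  let e : Fin m ≃ {i // i ∉ U} :=
    (Uᶜ.orderIsoOfFin h).toEquiv.trans (Equiv.subtypeEquivRight fun i => Finset.mem_compl)
  rw [← det_submatrix_equiv_self e]
  rfl

theorem det_updateRow_updateRow_swap (A : Matrix V V R) {i j : V} (hij : i ≠ j) (u v : V → R) :
    ((A.updateRow i u).updateRow j v).det = -((A.updateRow i v).updateRow j u).det := by
  have h : (A.updateRow i u).updateRow j v =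
      ((A.updateRow i v).updateRow j u).submatrix (Equiv.swap i j) id := by
    ext a b
    by_cases ha : a = i
    · subst ha
      simp [updateRow_ne hij]
    · by_cases hb : a = j
      · subst hb
        simp [updateRow_ne hij]
      · simp [Equiv.swap_apply_of_ne_of_ne ha hb, updateRow_ne ha, updateRow_ne hb]
  rw [h, det_permute, Equiv.Perm.sign_swap hij]
  simp

theorem adjugate_replaceRowsByOne_self (A : Matrix V V R) (U : Finset V) (l : V) :
    adjugate (A.replaceRowsByOne U) l l = (A.replaceRowsByOne (insert l U)).det := by
  rw [adjugate_apply, replaceRowsByOne_updateRow_single]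

theorem adjugate_replaceRowsByOne_eq_zero (A : Matrix V V R) {U : Finset V} {k l : V}
    (hk : k ∈ U) (hkl : k ≠ l) : adjugate (A.replaceRowsByOne U) k l = 0 := by
  rw [adjugate_apply]
  refine det_zero_of_row_eq hkl ?_
  ext b
  simp [updateRow_ne hkl, replaceRowsByOne, hk, one_apply, Pi.single_apply, eq_comm]

theorem adjugate_replaceRowsByOne_expand (A : Matrix V V R) {U : Finset V} {k l : V}
    (hk : k ∉ U) (hkl : k ≠ l) :
    adjugate (A.replaceRowsByOne U) k l =
      -∑ j, A k j * adjugate (A.replaceRowsByOne (insert k U)) j l := by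
  rw [adjugate_apply, det_eq_sum_mul_adjugate_row _ k, ← Finset.sum_neg_distrib]
  refine Finset.sum_congr rfl fun j _ => ?_
  rw [adjugate_apply, adjugate_apply, det_updateRow_updateRow_swap _ hkl.symm,
    updateRow_comm _ hkl.symm, replaceRowsByOne_updateRow_single]
  simp [updateRow_ne hkl, replaceRowsByOne, hk]

end Matrix

namespace SimpleGraph

variable {V R : Type*} [Fintype V] [DecidableEq V] [CommRing R]
  (H : SimpleGraph V) [DecidableRel H.Adj]

theorem sum_path_self (U : Finset V) {l : V} (hl : l ∉ U) (f : H.Walk l l → R) :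
    ∑ p : H.Path l l with ∀ u ∈ p.1.support, u ∉ U, f p.1 = f Walk.nil := by
  rw [Finset.sum_eq_single_of_mem Path.nil (by simpa [Path.nil] using hl)]
  · rfl
  · intro p _ hp
    exact (hp (Path.loop_eq p)).elim

theorem sum_path_eq_sum_adj (U : Finset V) {k l : V} (hk : k ∉ U) (hkl : k ≠ l)
    (f : H.Walk k l → R) :
    ∑ p : H.Path k l with ∀ u ∈ p.1.support, u ∉ U, f p.1 =
      ∑ j : {j // H.Adj k j}, ∑ q : H.Path j l with ∀ u ∈ q.1.support, u ∉ insert k U,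
        f (Walk.cons j.2 q.1) := by
  rw [Finset.sum_sigma']
  symm
  have hns : ∀ {j : V} (q : H.Walk j l), (∀ u ∈ q.support, u ∉ insert k U) →
      k ∉ q.support := fun q hq h => hq k h (Finset.mem_insert_self _ _)
  refine Finset.sum_bij
    (fun x hx => ⟨Walk.cons x.1.2 x.2.1, x.2.2.cons (hns _ (by simpa using hx))⟩)
    ?_ ?_ ?_ ?_
  · rintro ⟨⟨j, hj⟩, ⟨q, hq⟩⟩ hx
    simp only [Finset.mem_sigma, Finset.mem_univ, Finset.mem_filter, true_and,
      Finset.mem_insert, not_or] at hx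
    simp only [Finset.mem_filter, Finset.mem_univ, true_and, Walk.support_cons,
      List.mem_cons, forall_eq_or_imp]
    exact ⟨hk, fun u hu => (hx u hu).2⟩
  · rintro ⟨⟨j, hj⟩, ⟨q, hq⟩⟩ _ ⟨⟨j', hj'⟩, ⟨q', hq'⟩⟩ _ h
    simp only [Subtype.mk.injEq, Walk.cons.injEq] at h
    obtain ⟨rfl, h⟩ := h
    obtain rfl := eq_of_heq h
    rfl
  · rintro ⟨p, hp⟩ hx
    cases p with
    | nil => exact (hkl rfl).elim
    | cons h q =>
      rw [Walk.cons_isPath_iff] at hp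
      simp only [Finset.mem_filter, Finset.mem_univ, true_and, Walk.support_cons,
        List.mem_cons, forall_eq_or_imp] at hx
      refine ⟨⟨⟨_, h⟩, ⟨q, hp.1⟩⟩, ?_, rfl⟩
      simp only [Finset.mem_sigma, Finset.mem_univ, Finset.mem_filter, true_and,
        Finset.mem_insert, not_or]
      exact fun u hu => ⟨fun huk => hp.2 (huk ▸ hu), hx.2 u hu⟩
  · intros
    rfl

theorem adjugate_replaceRowsByOne_eq_sum_path (A : Matrix V V R)
    (hzero : ∀ i j, i ≠ j → ¬ H.Adj i j → A i j = 0) (l : V) (U : Finset V) (k : V)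
    (hk : k ∉ U) (hl : l ∉ U) :
    Matrix.adjugate (A.replaceRowsByOne U) k l =
      ∑ p : H.Path k l with ∀ u ∈ p.1.support, u ∉ U,
        (-1) ^ p.1.length * (A.replaceRowsByOne (p.1.support.toFinset ∪ U)).det *
          (p.1.darts.map fun d => A d.fst d.snd).prod := by
  induction hm : Uᶜ.card generalizing U k with
  | zero =>
    rw [Finset.card_eq_zero] at hm
    exact absurd (Finset.mem_compl.2 hk) (by simp [hm])
  | succ m ih =>
    by_cases hkl : k = l
    · subst hkl
      rw [sum_path_self H U hk fun p => (-1) ^ p.length *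
          (A.replaceRowsByOne (p.support.toFinset ∪ U)).det *
          (p.darts.map fun d => A d.fst d.snd).prod]
      simp [Matrix.adjugate_replaceRowsByOne_self]
    have hm' : (insert k U)ᶜ.card = m := by
      rw [Finset.compl_insert, Finset.card_erase_of_mem (Finset.mem_compl.2 hk), hm,
        Nat.add_sub_cancel]
    have hl' : l ∉ insert k U := by simp [hl, Ne.symm hkl]
    rw [sum_path_eq_sum_adj H U hk hkl fun p => (-1) ^ p.length *
          (A.replaceRowsByOne (p.support.toFinset ∪ U)).det *
          (p.darts.map fun d => A d.fst d.snd).prod,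
      Matrix.adjugate_replaceRowsByOne_expand A hk hkl, ← Finset.sum_neg_distrib]
    trans ∑ j with H.Adj k j,
        -(A k j * Matrix.adjugate (A.replaceRowsByOne (insert k U)) j l)
    · refine (Finset.sum_filter_of_ne fun j _ hj => ?_).symm
      by_contra hadj
      apply hj
      by_cases hkj : k = j
      · subst hkj
        rw [Matrix.adjugate_replaceRowsByOne_eq_zero A (Finset.mem_insert_self k U) hkl]
        simp
      · simp [hzero k j hkj hadj]
    rw [Finset.sum_subtype (p := H.Adj k) _ (by simp)]
    refine Finset.sum_congr rfl fun j _ => ?_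
    by_cases hj : (j : V) ∈ insert k U
    · rw [Matrix.adjugate_replaceRowsByOne_eq_zero A hj (ne_of_mem_of_not_mem hj hl'),
        Finset.sum_eq_zero]
      · simp
      · intro q hq
        exact ((Finset.mem_filter.1 hq).2 j q.1.start_mem_support hj).elim
    · rw [ih (insert k U) j hj hl' hm', Finset.mul_sum, ← Finset.sum_neg_distrib]
      refine Finset.sum_congr rfl fun q _ => ?_
      simp only [Walk.length_cons, Walk.support_cons, List.toFinset_cons, Walk.darts_cons,
        List.map_cons, List.prod_cons, Finset.insert_union, Finset.union_insert]
      ring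

end SimpleGraph

/-- **Path expansion of almost-principal minors.** If `Σ` is a symmetric matrix whose
support conforms to the graph `H`, then for distinct `k, l` the cofactor
`(-1)^{k+l} det(Σ_{N∖k, N∖l})` is the sum over all paths `p` in `H` from `k` to `l`
of `(-1)^{|V(p)|-1} · det(Σ_{N∖V(p), N∖V(p)}) · σ_p`. -/
theorem almostPrincipalMinor_eq_sum_over_paths {n : ℕ} (H : SimpleGraph (Fin n))
    [DecidableRel H.Adj] (S : Matrix (Fin n) (Fin n) ℝ) (hsym : S.IsSymm)
    (hzero : ∀ i j : Fin n, i ≠ j → ¬ H.Adj i j → S i j = 0)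
    (k l : Fin n) (hkl : k ≠ l) :
    (-1 : ℝ) ^ ((k : ℕ) + (l : ℕ)) *
        (S.submatrix
          (({k}ᶜ : Finset (Fin n)).orderEmbOfFin
            (show ({k}ᶜ : Finset (Fin n)).card = n - 1 by simp [Finset.card_compl]))
          (({l}ᶜ : Finset (Fin n)).orderEmbOfFin
            (show ({l}ᶜ : Finset (Fin n)).card = n - 1 by simp [Finset.card_compl]))).det =
      ∑ p : H.Path k l,
        (-1 : ℝ) ^ ((p : H.Walk k l).support.toFinset.card - 1) *
          (S.submatrix
            ((((p : H.Walk k l).support.toFinset)ᶜ).orderEmbOfFin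
              (show (((p : H.Walk k l).support.toFinset)ᶜ).card
                  = n - (p : H.Walk k l).support.toFinset.card by
                simp [Finset.card_compl]))
            ((((p : H.Walk k l).support.toFinset)ᶜ).orderEmbOfFin
              (show (((p : H.Walk k l).support.toFinset)ᶜ).card
                  = n - (p : H.Walk k l).support.toFinset.card by
                simp [Finset.card_compl]))).det *
          ((p : H.Walk k l).darts.map fun d => S d.toProd.1 d.toProd.2).prod := by
  have hL : (-1 : ℝ) ^ ((k : ℕ) + (l : ℕ)) *
      (S.submatrix
        (({k}ᶜ : Finset (Fin n)).orderEmbOfFin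
          (show ({k}ᶜ : Finset (Fin n)).card = n - 1 by simp [Finset.card_compl]))
        (({l}ᶜ : Finset (Fin n)).orderEmbOfFin
          (show ({l}ᶜ : Finset (Fin n)).card = n - 1 by simp [Finset.card_compl]))).det =
      Matrix.adjugate S k l := by
    obtain _ | m := n
    · exact k.elim0
    · have hadj : Matrix.adjugate S k l = Matrix.adjugate S l k := by
        conv_lhs => rw [← hsym.eq, ← Matrix.adjugate_transpose, Matrix.transpose_apply]
      rw [hadj, Matrix.adjugate_fin_succ_eq_det_submatrix]
      simp only [Finset.orderEmbOfFin_compl_singleton]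
      rfl
  rw [hL]
  have h := H.adjugate_replaceRowsByOne_eq_sum_path S hzero l ∅ k (by simp) (by simp)
  rw [Matrix.replaceRowsByOne_empty] at h
  simp only [Finset.notMem_empty, not_false_eq_true, implies_true, Finset.filter_true,
    Finset.union_empty] at h
  rw [h]
  refine Finset.sum_congr rfl fun p _ => ?_
  rw [Matrix.det_submatrix_orderEmbOfFin_compl,
    List.toFinset_card_of_nodup p.2.support_nodup, SimpleGraph.Walk.length_support,
    Nat.add_sub_cancel]
end

section
/- Let G and H be simple graphs on N = {1,…,n} such that for every pair k ≠ l with {k,l} ∉ E_G there is at most one path in H from k to l. Then a polynomial f ∈ ℝ[σ_{ij} : 1 ≤ i < j ≤ n] vanishes at (the off-diagonal entries of) every matrix in M₁(G,H) if and only if f lies in the ideal generated by the variables σ_{ij} with {i,j} ∉ E_H together with the monomials σ_p := ∏_{edges {a,b} of p} σ_{ab} for all paths p in H whose endpoints k, l satisfy {k,l} ∉ E_G. -/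
/-- The square-free monomial `σ_p` associated to a walk `p`: the product of the
variables `σ_{ab}` over the edges `{a,b}` of `p`, in the polynomial ring in the
variables `σ_{ij}`, `1 ≤ i < j ≤ n`. -/
noncomputable def pathMonomial {n : ℕ} {H : SimpleGraph (Fin n)} {k l : Fin n}
    (p : H.Walk k l) : MvPolynomial {q : Fin n × Fin n // q.1 < q.2} ℝ :=
  (p.darts.map fun d =>
    if h : d.toProd.1 < d.toProd.2 then MvPolynomial.X ⟨d.toProd, h⟩
    else MvPolynomial.X ⟨(d.toProd.2, d.toProd.1),
      lt_of_le_of_ne (not_lt.mp h) d.adj.ne'⟩).prod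

open scoped Matrix

open Matrix in
/-- If an invertible symmetric matrix supported on `H` has a zero entry along every path in `H`
from `k` to `l`, then the `(k, l)` entry of its inverse vanishes. -/
theorem Matrix.inv_apply_eq_zero_of_forall_path {V : Type*} [Fintype V] [DecidableEq V]
    {H : SimpleGraph V} {S : Matrix V V ℝ} (hS : IsUnit S.det) (hsymm : S.IsSymm)
    (hH : ∀ i j, i ≠ j → ¬ H.Adj i j → S i j = 0) {k l : V}
    (hp : ∀ p : H.Walk k l, p.IsPath → ∃ i j, s(i, j) ∈ p.edges ∧ S i j = 0) :
    S⁻¹ k l = 0 := by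
  classical
  let K : SimpleGraph V :=
    { Adj := fun i j => i ≠ j ∧ S i j ≠ 0
      symm := ⟨fun i j h => ⟨h.1.symm, by rw [hsymm.apply]; exact h.2⟩⟩
      loopless := ⟨fun i h => h.1 rfl⟩ }
  have hKH : K ≤ H := fun i j h => by
    by_contra hij
    exact h.2 (hH i j h.1 hij)
  have hreach : ¬ K.Reachable k l := by
    rintro hr
    obtain ⟨q, hq⟩ := hr.exists_isPath
    obtain ⟨i, j, hij, h0⟩ := hp (q.mapLe hKH) (hq.mapLe hKH)
    rw [SimpleGraph.Walk.edges_mapLe_eq_edges] at hij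
    exact (q.adj_of_mem_edges hij).2 h0
  let D : Matrix V V ℝ := diagonal fun i => if K.Reachable k i then 1 else 0
  have hcomm : S * D = D * S := by
    ext i j
    simp only [D, mul_diagonal, diagonal_mul]
    by_cases hij : i = j
    · subst hij; ring
    by_cases h0 : S i j = 0
    · simp [h0]
    have hadj : K.Adj i j := ⟨hij, h0⟩
    have : K.Reachable k i ↔ K.Reachable k j :=
      ⟨fun h => h.trans hadj.reachable, fun h => h.trans hadj.symm.reachable⟩
    simp only [this]; ring
  have hinv : S⁻¹ * D = D * S⁻¹ := by
    calc S⁻¹ * D = S⁻¹ * (D * S) * S⁻¹ := by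
          rw [Matrix.mul_assoc, Matrix.mul_assoc, mul_nonsing_inv _ hS, Matrix.mul_one]
      _ = D * S⁻¹ := by
          rw [← hcomm, ← Matrix.mul_assoc, nonsing_inv_mul _ hS, Matrix.one_mul]
  have hentry := congrFun (congrFun hinv k) l
  simpa [D, mul_diagonal, diagonal_mul, hreach] using hentry.symm

/-- If `cons h p` is the unique path between its endpoints, then `p` is, too. -/
theorem SimpleGraph.Walk.eq_of_forall_path_eq_cons {V : Type*} {H : SimpleGraph V} {k v l : V}
    {h : H.Adj k v} {p : H.Walk v l} (huniq : ∀ q : H.Walk k l, q.IsPath → q = cons h p)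
    {q : H.Walk v l} (hq : q.IsPath) : q = p := by
  classical
  by_cases hk : k ∈ q.support
  · have hdrop := huniq _ (hq.dropUntil hk)
    have hv : v ∈ (q.dropUntil k hk).support := by simp [hdrop]
    have hnodup := hq.support_nodup
    rw [← q.take_spec hk, support_append, List.nodup_append] at hnodup
    rw [← cons_tail_support (q.dropUntil k hk), List.mem_cons] at hv
    rcases hv with hv | hv
    · exact absurd hv h.ne'
    · exact absurd rfl (hnodup.2.2 v (start_mem_support _) v hv)
  · have := huniq (cons h q) (hq.cons hk)
    injection this

/-- Suppose `p` is the only path in `H` from `k` to `l` and `S` is positive definite,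
supported on `H`, and nonzero along `p`. Then the solution of `S x = e_l` has `x k ≠ 0`. -/
theorem Matrix.PosDef.ne_zero_of_unique_path {V : Type*} [Fintype V] [DecidableEq V]
    {H : SimpleGraph V} {S : Matrix V V ℝ} (hS : S.PosDef)
    (hH : ∀ i j, i ≠ j → ¬ H.Adj i j → S i j = 0) {k l : V} {x : V → ℝ}
    (hx : S *ᵥ x = Pi.single l 1) (p : H.Walk k l) (hp : p.IsPath)
    (huniq : ∀ q : H.Walk k l, q.IsPath → q = p)
    (hne : ∀ i j, s(i, j) ∈ p.edges → S i j ≠ 0) : x k ≠ 0 := by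
  classical
  induction p with
  | nil =>
    rename_i l
    intro h0
    have hx0 : x ≠ 0 := by
      rintro rfl
      have := congrFun hx l
      simp at this
    have hpos := hS.dotProduct_mulVec_pos hx0
    rw [hx] at hpos
    simp [h0] at hpos
  | cons h p ih =>
    rename_i k v l
    intro h0
    rw [SimpleGraph.Walk.cons_isPath_iff] at hp
    have hkl : k ≠ l := by
      rintro rfl
      exact hp.2 p.end_mem_support
    refine ih hx hp.1 (fun q hq => SimpleGraph.Walk.eq_of_forall_path_eq_cons huniq hq)
      (fun i j hij => hne i j (by simp [hij])) ?_
    let K := H.deleteEdges {s(k, v)}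
    have hK : ∀ i j, K.Reachable k i → ¬ K.Reachable k j → H.Adj i j → i = k ∧ j = v := by
      intro i j hi hj hij
      by_cases hedge : s(i, j) = s(k, v)
      · rcases Sym2.eq_iff.mp hedge with h | h
        · exact h
        · exact absurd (by rw [h.2]) hj
      · exact absurd (hi.trans (SimpleGraph.Adj.reachable
          (SimpleGraph.deleteEdges_adj.mpr ⟨hij, hedge⟩))) hj
    have hl : ¬ K.Reachable k l := by
      intro hr
      obtain ⟨q, hq⟩ := hr.exists_isPath
      have hKH : K ≤ H := SimpleGraph.deleteEdges_le _
      have hedges : s(k, v) ∈ q.edges := by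
        rw [← SimpleGraph.Walk.edges_mapLe_eq_edges hKH, huniq _ (hq.mapLe hKH)]
        simp
      exact (SimpleGraph.deleteEdges_adj.mp (q.adj_of_mem_edges hedges)).2 rfl
    let y : V → ℝ := fun i => if K.Reachable k i then x i else 0
    have hrow : ∀ i, i ≠ l → ∑ j, S i j * x j = 0 := by
      intro i hi
      have := congrFun hx i
      simpa [Matrix.mulVec, dotProduct, hi] using this
    have hoff : ∀ i j, K.Reachable k i → ¬ K.Reachable k j → ¬ (i = k ∧ j = v) → S i j = 0 := by
      intro i j hi hj hij
      refine hH i j ?_ fun hadj => hij (hK i j hi hj hadj)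
      rintro rfl
      exact hj hi
    have hy : y = 0 := by
      by_contra hy
      have hpos := hS.dotProduct_mulVec_pos hy
      refine hpos.ne' (Finset.sum_eq_zero fun i _ => ?_)
      by_cases hi : K.Reachable k i
      · by_cases hik : i = k
        · simp [y, hik, h0]
        · have hil : i ≠ l := by
            rintro rfl
            exact hl hi
          have : (S *ᵥ y) i = 0 := by
            rw [← hrow i hil]
            refine Finset.sum_congr rfl fun j _ => ?_
            by_cases hj : K.Reachable k j
            · simp [y, hj]
            · simp [hoff i j hi hj (fun h => hik h.1)]
          simp [this]
      · simp [y, hi]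
    have hxK : ∀ i, K.Reachable k i → x i = 0 := fun i hi => by
      have := congrFun hy i
      simpa [y, hi] using this
    by_cases hv : K.Reachable k v
    · exact hxK v hv
    have hsum := hrow k hkl
    rw [Finset.sum_eq_single v] at hsum
    · exact (mul_eq_zero.mp hsum).resolve_left (hne k v (by simp))
    · intro j _ hj
      by_cases hjr : K.Reachable k j
      · simp [hxK j hjr]
      · simp [hoff k j (SimpleGraph.Reachable.refl k) hjr (fun h => hj h.2)]
    · simp

/-- If `p` is the only path in `H` from `k` to `l` and `S` is positive definite, supported on
`H`, and nonzero along `p`, then the `(k, l)` entry of `S⁻¹` is nonzero. -/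
theorem Matrix.PosDef.inv_apply_ne_zero_of_unique_path {V : Type*} [Fintype V] [DecidableEq V]
    {H : SimpleGraph V} {S : Matrix V V ℝ} (hS : S.PosDef)
    (hH : ∀ i j, i ≠ j → ¬ H.Adj i j → S i j = 0) {k l : V} (p : H.Walk k l) (hp : p.IsPath)
    (huniq : ∀ q : H.Walk k l, q.IsPath → q = p)
    (hne : ∀ i j, s(i, j) ∈ p.edges → S i j ≠ 0) : S⁻¹ k l ≠ 0 := by
  have hx : S *ᵥ S⁻¹.col l = Pi.single l 1 := by
    rw [← Matrix.mulVec_single_one, Matrix.mulVec_mulVec,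
      Matrix.mul_nonsing_inv _ ((Matrix.isUnit_iff_isUnit_det _).mp hS.isUnit), Matrix.one_mulVec]
  exact hS.ne_zero_of_unique_path (x := S⁻¹.col l) hH hx p hp huniq hne

/-- A symmetric real matrix with unit diagonal and small off-diagonal entries is positive
definite. -/
theorem Matrix.posDef_of_abs_off_diag_le {V : Type*} [Fintype V]
    {S : Matrix V V ℝ} (hsymm : S.IsSymm) (hdiag : ∀ i, S i i = 1)
    (hoff : ∀ i j, i ≠ j → |S i j| ≤ 1 / (Fintype.card V + 1)) : S.PosDef := by
  classical
  refine .of_dotProduct_mulVec_pos ((Matrix.conjTranspose_eq_transpose_of_trivial S).trans hsymm)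
    fun x hx => ?_
  set ε : ℝ := 1 / (Fintype.card V + 1) with hε
  have hε0 : 0 < ε := by positivity
  have hterm : ∀ i j, (if i = j then x i ^ 2 else 0) - ε * ((x i ^ 2 + x j ^ 2) / 2)
      ≤ x i * (S i j * x j) := by
    intro i j
    by_cases hij : i = j
    · subst hij
      simp only [if_true, hdiag]
      nlinarith [sq_nonneg (x i)]
    · simp only [hij, if_false, zero_sub]
      have h1 : |x i * (S i j * x j)| ≤ ε * ((x i ^ 2 + x j ^ 2) / 2) := by
        rw [show x i * (S i j * x j) = S i j * (x i * x j) by ring, abs_mul]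
        refine mul_le_mul (hoff i j hij) ?_ (abs_nonneg _) hε0.le
        rw [abs_le]
        constructor <;> nlinarith [sq_nonneg (x i + x j), sq_nonneg (x i - x j)]
      exact (abs_le.mp h1).1
  have hnorm : 0 < ∑ i, x i ^ 2 := by
    obtain ⟨i, hi⟩ := Function.ne_iff.mp hx
    exact Finset.sum_pos' (fun i _ => sq_nonneg _) ⟨i, Finset.mem_univ _, sq_pos_of_ne_zero hi⟩
  calc (0 : ℝ) < ε * ∑ i, x i ^ 2 := by positivity
    _ = ∑ i, ∑ j, ((if i = j then x i ^ 2 else 0) - ε * ((x i ^ 2 + x j ^ 2) / 2)) := by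
      simp only [Finset.sum_sub_distrib, Finset.sum_ite_eq, Finset.mem_univ, if_true,
        ← Finset.mul_sum, ← Finset.sum_div, Finset.sum_add_distrib, Finset.sum_const,
        Finset.card_univ, nsmul_eq_mul]
      rw [hε]
      field_simp
      ring
    _ ≤ ∑ i, ∑ j, x i * (S i j * x j) :=
      Finset.sum_le_sum fun i _ => Finset.sum_le_sum fun j _ => hterm i j
    _ = star x ⬝ᵥ (S *ᵥ x) := by
      simp [dotProduct, Matrix.mulVec, Finset.mul_sum]

/-- If a real polynomial vanishes at all points of a small cube in the coordinate subspace
spanned by `T`, then its coefficients at monomials supported in `T` vanish. -/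
theorem MvPolynomial.coeff_eq_zero_of_eval_eq_zero_on_cube {σ : Type*} {f : MvPolynomial σ ℝ}
    {T : Finset σ} {ε : ℝ} (hε : 0 < ε)
    (hf : ∀ t : σ → ℝ, (∀ i, |t i| ≤ ε) → (∀ i ∉ T, t i = 0) → eval t f = 0)
    {m : σ →₀ ℕ} (hm : m.support ⊆ T) : coeff m f = 0 := by
  classical
  let g := ∑ d ∈ f.support with d.support ⊆ T, monomial d (coeff d f)
  have hg : g = 0 := by
    refine funext_set (fun _ => Set.Icc (-ε) ε) (fun _ => Set.Icc_infinite (by linarith))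
      fun t ht => ?_
    rw [map_zero, ← hf (fun i => if i ∈ T then t i else 0)
      (fun i => by
        have := abs_le.mpr (ht i trivial)
        split_ifs
        · exact this
        · simpa using hε.le)
      (fun i hi => by simp [hi]), eval_eq _ f, map_sum, Finset.sum_filter]
    refine Finset.sum_congr rfl fun d _ => ?_
    split_ifs with hd
    · rw [eval_monomial, Finsupp.prod]
      congr 1
      exact Finset.prod_congr rfl fun i hi => by simp [hd hi]
    · obtain ⟨i, hi, hiT⟩ := Finset.not_subset.mp hd
      rw [Finset.prod_eq_zero hi (by simp [hiT, Finsupp.mem_support_iff.mp hi]), mul_zero]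
  have hcoeff : coeff m g = coeff m f := by
    simp only [g, coeff_sum, coeff_monomial, Finset.sum_ite_eq', Finset.mem_filter, hm,
      and_true, mem_support_iff]
    split_ifs with h
    · rfl
    · exact (not_not.mp h).symm
  rw [← hcoeff, hg, coeff_zero]

/-- The product of distinct variables divides each monomial whose support contains them. -/
theorem MvPolynomial.prod_X_dvd_monomial {σ R : Type*} [CommSemiring R] {L : List σ}
    (hL : L.Nodup) {m : σ →₀ ℕ} (hm : ∀ i ∈ L, i ∈ m.support) (c : R) :
    (L.map X).prod ∣ monomial m c := by
  classical
  rw [monomial_eq, ← List.prod_toFinset _ hL]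
  refine Dvd.dvd.mul_left ?_ _
  refine (Finset.prod_dvd_prod_of_dvd _
    (fun i => (X i : MvPolynomial σ R) ^ m i) fun i hi => ?_).trans
    (Finset.prod_dvd_prod_of_subset _ _ _ fun i hi => hm i (List.mem_toFinset.mp hi))
  exact dvd_pow_self _ (Finsupp.mem_support_iff.mp (hm i (List.mem_toFinset.mp hi)))

/-- The variable index of the edge underlying a dart. -/
def dartVar {n : ℕ} {H : SimpleGraph (Fin n)} (d : H.Dart) :
    {q : Fin n × Fin n // q.1 < q.2} :=
  if h : d.toProd.1 < d.toProd.2 then ⟨d.toProd, h⟩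
  else ⟨(d.toProd.2, d.toProd.1), lt_of_le_of_ne (not_lt.mp h) d.adj.ne'⟩

theorem mk_dartVar {n : ℕ} {H : SimpleGraph (Fin n)} (d : H.Dart) :
    s((dartVar d).1.1, (dartVar d).1.2) = d.edge := by
  unfold dartVar
  split_ifs
  · rfl
  · exact Sym2.eq_swap

theorem pathMonomial_eq {n : ℕ} {H : SimpleGraph (Fin n)} {k l : Fin n} (p : H.Walk k l) :
    pathMonomial p = ((p.darts.map dartVar).map MvPolynomial.X).prod := by
  unfold pathMonomial
  rw [List.map_map]
  congr 2
  funext d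
  simp only [Function.comp, dartVar]
  split_ifs <;> rfl

theorem mk_mem_edges_of_mem_map_dartVar {n : ℕ} {H : SimpleGraph (Fin n)} {k l : Fin n}
    {p : H.Walk k l} {q : {q : Fin n × Fin n // q.1 < q.2}} (hq : q ∈ p.darts.map dartVar) :
    s(q.1.1, q.1.2) ∈ p.edges := by
  obtain ⟨d, hd, rfl⟩ := List.mem_map.mp hq
  rw [mk_dartVar]
  exact List.mem_map_of_mem hd

theorem nodup_map_dartVar {n : ℕ} {H : SimpleGraph (Fin n)} {k l : Fin n} {p : H.Walk k l}
    (hp : p.IsPath) : (p.darts.map dartVar).Nodup := by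
  refine List.Nodup.of_map (fun q => s(q.1.1, q.1.2)) ?_
  rw [List.map_map]
  have : (fun q : {q : Fin n × Fin n // q.1 < q.2} => s(q.1.1, q.1.2)) ∘ dartVar =
      (SimpleGraph.Dart.edge : H.Dart → _) := funext mk_dartVar
  rw [this]
  exact hp.isTrail.edges_nodup

theorem eval_pathMonomial_eq_zero {n : ℕ} {H : SimpleGraph (Fin n)} {k l : Fin n}
    {S : Matrix (Fin n) (Fin n) ℝ} (hS : S.IsSymm) {p : H.Walk k l} {i j : Fin n}
    (hij : s(i, j) ∈ p.edges) (h0 : S i j = 0) :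
    MvPolynomial.eval (fun q => S q.1.1 q.1.2) (pathMonomial p) = 0 := by
  obtain ⟨d, hd, hde⟩ := List.mem_map.mp hij
  rw [pathMonomial_eq, map_list_prod, List.prod_eq_zero_iff, List.map_map, List.mem_map]
  refine ⟨dartVar d, List.mem_map_of_mem hd, ?_⟩
  rw [← mk_dartVar] at hde
  rcases Sym2.eq_iff.mp hde with h | h
  · simpa [h.1, h.2] using h0
  · simpa [h.1, h.2, hS.apply i j] using h0

/-- The symmetric matrix with unit diagonal and off-diagonal entries `t`. -/
def correlationMatrix {n : ℕ} (t : {q : Fin n × Fin n // q.1 < q.2} → ℝ) :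
    Matrix (Fin n) (Fin n) ℝ :=
  fun i j => if h : i < j then t ⟨(i, j), h⟩ else if h : j < i then t ⟨(j, i), h⟩ else 1

theorem correlationMatrix_isSymm {n : ℕ} (t : {q : Fin n × Fin n // q.1 < q.2} → ℝ) :
    (correlationMatrix t).IsSymm := by
  ext i j
  rw [Matrix.transpose_apply]
  unfold correlationMatrix
  rcases lt_trichotomy i j with h | rfl | h
  · simp [h, h.not_gt]
  · rfl
  · simp [h, h.not_gt]

theorem correlationMatrix_self {n : ℕ} (t : {q : Fin n × Fin n // q.1 < q.2} → ℝ) (i : Fin n) :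
    correlationMatrix t i i = 1 := by
  simp [correlationMatrix]

theorem correlationMatrix_apply {n : ℕ} (t : {q : Fin n × Fin n // q.1 < q.2} → ℝ)
    (q : {q : Fin n × Fin n // q.1 < q.2}) : correlationMatrix t q.1.1 q.1.2 = t q := by
  simp [correlationMatrix, q.2]

theorem exists_correlationMatrix_apply_eq {n : ℕ} {i j : Fin n} (hij : i ≠ j) :
    ∃ q : {q : Fin n × Fin n // q.1 < q.2}, s(q.1.1, q.1.2) = s(i, j) ∧
      ∀ t, correlationMatrix t i j = t q := by
  rcases lt_or_gt_of_ne hij with h | h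
  · exact ⟨⟨(i, j), h⟩, rfl, fun t => correlationMatrix_apply t ⟨(i, j), h⟩⟩
  · exact ⟨⟨(j, i), h⟩, Sym2.eq_swap, fun t => by
      rw [← (correlationMatrix_isSymm t).apply]
      exact correlationMatrix_apply t ⟨(j, i), h⟩⟩

/-- **Vanishing ideal of `M₁(G,H)` is monomial.** Suppose for every non-edge `kl` of
`G` there is at most one path in `H` from `k` to `l`. Then a polynomial in the
off-diagonal variables vanishes on the correlation model `M₁(G,H)` if and only if it
lies in the ideal generated by the variables `σ_{ij}` for non-edges `ij` of `H`
together with the path monomials `σ_p` for paths `p` in `H` whose endpoints form a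
non-edge of `G`. -/
theorem vanishingIdeal_doubleMarkov_eq_monomialIdeal {n : ℕ}
    (G H : SimpleGraph (Fin n))
    (huniq : ∀ k l : Fin n, k ≠ l → ¬ G.Adj k l →
      ∀ p q : H.Walk k l, p.IsPath → q.IsPath → p = q)
    (f : MvPolynomial {q : Fin n × Fin n // q.1 < q.2} ℝ) :
    (∀ S : Matrix (Fin n) (Fin n) ℝ, S.PosDef → (∀ i, S i i = 1) →
        (∀ i j : Fin n, i ≠ j → ¬ G.Adj i j → S⁻¹ i j = 0) →
        (∀ i j : Fin n, i ≠ j → ¬ H.Adj i j → S i j = 0) →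
        MvPolynomial.eval (fun q => S q.1.1 q.1.2) f = 0) ↔
      f ∈ Ideal.span
        ({g | ∃ q : {q : Fin n × Fin n // q.1 < q.2}, ¬ H.Adj q.1.1 q.1.2 ∧
            g = MvPolynomial.X q} ∪
          {g | ∃ (k l : Fin n) (p : H.Walk k l), k ≠ l ∧ p.IsPath ∧ ¬ G.Adj k l ∧
            g = pathMonomial p}) := by
  classical
  constructor
  · intro hf
    rw [f.as_sum]
    refine Ideal.sum_mem _ fun m _ => ?_
    by_contra hm
    have hmem : ∀ g, g ∣ MvPolynomial.monomial m (MvPolynomial.coeff m f) →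
        ¬ ((∃ q : {q : Fin n × Fin n // q.1 < q.2}, ¬ H.Adj q.1.1 q.1.2 ∧
            g = MvPolynomial.X q) ∨
          ∃ (k l : Fin n) (p : H.Walk k l), k ≠ l ∧ p.IsPath ∧ ¬ G.Adj k l ∧
            g = pathMonomial p) :=
      fun g hg hgen => hm (Ideal.mem_of_dvd _ hg (Ideal.subset_span hgen))
    have hadj : ∀ q ∈ m.support, H.Adj q.1.1 q.1.2 := by
      intro q hq
      by_contra hqH
      refine hmem (MvPolynomial.X q) ?_ (Or.inl ⟨q, hqH, rfl⟩)
      simpa using MvPolynomial.prod_X_dvd_monomial (List.nodup_singleton q)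
        (by simpa using hq) (MvPolynomial.coeff m f)
    have hpath : ∀ k l : Fin n, k ≠ l → ¬ G.Adj k l → ∀ p : H.Walk k l, p.IsPath →
        ∃ q ∉ m.support, s(q.1.1, q.1.2) ∈ p.edges := by
      intro k l hkl hG p hp
      by_contra! hall
      refine hmem (pathMonomial p) ?_ (Or.inr ⟨k, l, p, hkl, hp, hG, rfl⟩)
      rw [pathMonomial_eq]
      refine MvPolynomial.prod_X_dvd_monomial (nodup_map_dartVar hp) (fun q hq => ?_) _
      by_contra hqm
      exact hall q hqm (mk_mem_edges_of_mem_map_dartVar hq)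
    have hcoeff : MvPolynomial.coeff m f = 0 := by
      refine MvPolynomial.coeff_eq_zero_of_eval_eq_zero_on_cube
        (ε := 1 / (Fintype.card (Fin n) + 1)) (by positivity) (fun t ht hT => ?_)
        (Finset.Subset.refl m.support)
      have hsymm := correlationMatrix_isSymm t
      have hpos : (correlationMatrix t).PosDef := by
        refine Matrix.posDef_of_abs_off_diag_le hsymm (correlationMatrix_self t)
          fun i j hij => ?_
        obtain ⟨q, -, hq⟩ := exists_correlationMatrix_apply_eq hij
        rw [hq]
        exact ht q
      have hsupp : ∀ i j : Fin n, i ≠ j → ¬ H.Adj i j → correlationMatrix t i j = 0 := by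
        intro i j hij hH
        obtain ⟨q, hqe, hq⟩ := exists_correlationMatrix_apply_eq hij
        rw [hq]
        refine hT q fun hqm => hH ?_
        rw [← SimpleGraph.mem_edgeSet, ← hqe]
        exact hadj q hqm
      simpa only [correlationMatrix_apply] using hf (correlationMatrix t) hpos
        (correlationMatrix_self t) (fun k l hkl hG =>
          Matrix.inv_apply_eq_zero_of_forall_path
            ((Matrix.isUnit_iff_isUnit_det _).mp hpos.isUnit) hsymm hsupp fun p hp => by
              obtain ⟨q, hqm, hqe⟩ := hpath k l hkl hG p hp
              exact ⟨q.1.1, q.1.2, hqe, by rw [correlationMatrix_apply]; exact hT q hqm⟩) hsupp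
    rw [hcoeff, MvPolynomial.monomial_zero] at hm
    exact hm (Ideal.zero_mem _)
  · intro hf S hS _ hG hH
    have hsymm : S.IsSymm := 
      (Matrix.conjTranspose_eq_transpose_of_trivial S).symm.trans hS.isHermitian
    rw [← RingHom.mem_ker]
    refine Ideal.span_le.mpr ?_ hf
    rintro g (⟨q, hq, rfl⟩ | ⟨k, l, p, hkl, hp, hkG, rfl⟩)
    · simpa using hH _ _ q.2.ne hq
    · rw [SetLike.mem_coe, RingHom.mem_ker]
      by_contra h0
      exact hS.inv_apply_ne_zero_of_unique_path hH p hp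
        (fun q hq => huniq k l hkl hkG q p hq hp)
        (fun i j hij hz => h0 (eval_pathMonomial_eq_zero hsymm hij hz)) (hG k l hkl hkG)
end

section
/- Let G and H be simple graphs on N = {1,…,n} such that for every pair k ≠ l with {k,l} ∉ E_G there is at most one path in H from k to l. Then the set M(G,H), viewed as a subset of the space of real symmetric n×n matrices with the Euclidean topology, is connected. -/
namespace Matrix

variable {V : Type*}

/-- The graph whose edges are the positions of the nonzero off-diagonal entries of a
symmetric matrix. -/
def supportGraph (S : Matrix V V ℝ) (hS : S.IsSymm) : SimpleGraph V where
  Adj i j := i ≠ j ∧ S i j ≠ 0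
  symm := ⟨fun i j h => ⟨h.1.symm, by rw [hS.apply i j]; exact h.2⟩⟩
  loopless := ⟨fun _ h => h.1 rfl⟩

variable [Fintype V] [DecidableEq V]

/-- The inverse of a symmetric matrix vanishes between distinct components of its
support graph. -/
theorem inv_apply_eq_zero_of_not_reachable {S : Matrix V V ℝ} (hS : S.IsSymm)
    (hdet : IsUnit S.det) {k l : V} (h : ¬ (S.supportGraph hS).Reachable k l) :
    S⁻¹ k l = 0 := by
  classical
  let P : Matrix V V ℝ :=
    diagonal fun i => if (S.supportGraph hS).Reachable k i then 1 else 0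
  have hcomm : S * P = P * S := by
    ext i j
    simp only [P, mul_diagonal, diagonal_mul]
    by_cases hij : i ≠ j ∧ S i j ≠ 0
    · have hadj : (S.supportGraph hS).Adj i j := hij
      have hiff : (S.supportGraph hS).Reachable k i ↔ (S.supportGraph hS).Reachable k j :=
        ⟨fun h => h.trans hadj.reachable, fun h => h.trans hadj.symm.reachable⟩
      simp only [hiff]
      ring
    · by_cases hne : i = j
      · subst hne
        ring
      · have h0 : S i j = 0 := by
          by_contra h0
          exact hij ⟨hne, h0⟩
        simp [h0]
  have hinv : P * S⁻¹ = S⁻¹ * P := by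
    calc P * S⁻¹ = S⁻¹ * S * P * S⁻¹ := by rw [nonsing_inv_mul _ hdet, one_mul]
      _ = S⁻¹ * P * (S * S⁻¹) := by
        rw [Matrix.mul_assoc S⁻¹ S P, hcomm]
        simp only [Matrix.mul_assoc]
      _ = S⁻¹ * P := by rw [mul_nonsing_inv _ hdet, mul_one]
  have hkl := congrFun (congrFun hinv k) l
  simpa [P, mul_diagonal, diagonal_mul, h] using hkl

/-- Across a bridge `uv` of the support graph, a vector annihilated by the rows on the
side of `u` and vanishing at `u` also vanishes at `v`. -/
theorem PosDef.eq_zero_of_isBridge {S : Matrix V V ℝ} (hpos : S.PosDef) (hS : S.IsSymm)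
    {u v : V} (hadj : (S.supportGraph hS).Adj u v)
    (hbr : ¬ ((S.supportGraph hS).deleteEdges {s(u, v)}).Reachable u v)
    {x : V → ℝ} (hx : ∀ i, ((S.supportGraph hS).deleteEdges {s(u, v)}).Reachable u i →
      (S *ᵥ x) i = 0)
    (hu : x u = 0) : x v = 0 := by
  classical
  set K := (S.supportGraph hS).deleteEdges {s(u, v)} with hK
  have hcross : ∀ i j, K.Reachable u i → ¬ K.Reachable u j → S i j ≠ 0 → i = u ∧ j = v := by
    intro i j hi hj hij
    have hne : i ≠ j := by
      rintro rfl
      exact hj hi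
    have hnot : ¬ K.Adj i j := fun h => hj (hi.trans h.reachable)
    rw [hK, SimpleGraph.deleteEdges_adj] at hnot
    have hmem : s(i, j) = s(u, v) := by
      by_contra hmem
      exact hnot ⟨⟨hne, hij⟩, hmem⟩
    rcases Sym2.eq_iff.1 hmem with h | h
    · exact h
    · exact absurd (h.1 ▸ hi) hbr
  let y : V → ℝ := fun i => if K.Reachable u i then x i else 0
  have hzero : ∀ i, y i * (S *ᵥ y) i = 0 := by
    intro i
    by_cases hi : K.Reachable u i
    · by_cases hiu : i = u
      · subst hiu
        simp [y, hu]
      · have : (S *ᵥ y) i = (S *ᵥ x) i := by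
          refine Finset.sum_congr rfl fun j _ => ?_
          by_cases hj : K.Reachable u j
          · simp [y, hj]
          · have h0 : S i j = 0 := by
              by_contra h0
              exact hiu (hcross i j hi hj h0).1
            simp [h0]
        rw [this, hx i hi, mul_zero]
    · simp [y, hi]
  have hy : y = 0 := by
    by_contra hy
    have hlt := hpos.dotProduct_mulVec_pos hy
    have h0 : star y ⬝ᵥ (S *ᵥ y) = 0 := Finset.sum_eq_zero fun i _ => by simpa using hzero i
    exact hlt.ne' h0
  have hrow : (S *ᵥ x) u = S u v * x v := by
    refine Finset.sum_eq_single v (fun j _ hj => ?_) (by simp)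
    by_cases hr : K.Reachable u j
    · have : y j = 0 := congrFun hy j
      simp only [y, if_pos hr] at this
      simp [this]
    · have h0 : S u j = 0 := by
        by_contra h0
        exact hj (hcross u j (SimpleGraph.Reachable.refl _) hr h0).2
      simp [h0]
  rw [hx u (SimpleGraph.Reachable.refl _)] at hrow
  exact (mul_eq_zero.1 hrow.symm).resolve_left hadj.2

end Matrix

namespace SimpleGraph

variable {V : Type*}

/-- Deleting an edge which is not a bridge preserves reachability. -/
theorem Reachable.deleteEdges_of_reachable {G : SimpleGraph V} {u v : V}
    (h : (G.deleteEdges {s(u, v)}).Reachable u v) {k l : V} (hkl : G.Reachable k l) :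
    (G.deleteEdges {s(u, v)}).Reachable k l := by
  obtain ⟨p⟩ := hkl
  induction p with
  | nil => exact Reachable.refl _
  | @cons a b _ hab _ ih =>
    refine Reachable.trans ?_ ih
    by_cases hmem : s(a, b) = s(u, v)
    · rcases Sym2.eq_iff.1 hmem with ⟨rfl, rfl⟩ | ⟨rfl, rfl⟩
      · exact h
      · exact h.symm
    · exact (deleteEdges_adj.2 ⟨hab, hmem⟩ : (G.deleteEdges {s(u, v)}).Adj a b).reachable

/-- Every edge of the unique path between two vertices is a bridge. -/
theorem Walk.not_reachable_deleteEdges_of_unique {G : SimpleGraph V} {k l : V}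
    {p : G.Walk k l} (huniq : ∀ q : G.Walk k l, q.IsPath → q = p) {u v : V}
    (he : s(u, v) ∈ p.edges) : ¬ (G.deleteEdges {s(u, v)}).Reachable u v := by
  intro h
  obtain ⟨q, hq⟩ := (Reachable.deleteEdges_of_reachable h p.reachable).exists_isPath
  have hle : G.deleteEdges {s(u, v)} ≤ G := deleteEdges_le _
  rw [← huniq (q.mapLe hle) (hq.mapLe hle), Walk.edges_mapLe_eq_edges] at he
  have := q.edges_subset_edgeSet he
  simp at this

end SimpleGraph

namespace Matrix

variable {V : Type*} [Fintype V] [DecidableEq V]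

/-- Vanishing propagates along a path of bridges in the support graph. -/
theorem PosDef.eq_zero_of_path_of_bridges {S : Matrix V V ℝ} (hpos : S.PosDef)
    (hS : S.IsSymm) {k l : V} (p : (S.supportGraph hS).Walk k l) (hp : p.IsPath)
    (hbr : ∀ u v, s(u, v) ∈ p.edges →
      ¬ ((S.supportGraph hS).deleteEdges {s(u, v)}).Reachable u v)
    {x : V → ℝ} (hx : ∀ i, i ≠ l → (S *ᵥ x) i = 0) (hk : x k = 0) : x l = 0 := by
  induction p with
  | nil => exact hk
  | @cons a b c hab p ih =>
    rw [SimpleGraph.Walk.cons_isPath_iff] at hp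
    refine ih hp.1 (fun u v he => hbr u v (by simp [he])) hx ?_
    have hb := hbr a b (by simp)
    refine hpos.eq_zero_of_isBridge hS hab hb (fun i hi => hx i ?_) hk
    rintro rfl
    refine hb (hi.trans ?_)
    refine (SimpleGraph.Walk.reachable (p.toDeleteEdges {s(a, b)} fun e he hmem => ?_)).symm
    rw [Set.mem_singleton_iff] at hmem
    subst hmem
    exact hp.2 (p.fst_mem_support_of_mem_edges he)

/-- An entry of the inverse of a positive definite matrix is nonzero if the
corresponding vertices are joined by exactly one path in the support graph. -/
theorem PosDef.inv_apply_ne_zero_of_unique_path_s8 {S : Matrix V V ℝ} (hpos : S.PosDef)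
    (hS : S.IsSymm) {k l : V} (hr : (S.supportGraph hS).Reachable k l)
    (huniq : ∀ p q : (S.supportGraph hS).Walk k l, p.IsPath → q.IsPath → p = q) :
    S⁻¹ k l ≠ 0 := by
  intro h0
  obtain ⟨p, hp⟩ := hr.exists_isPath
  have hdet : IsUnit S.det := hpos.det_pos.ne'.isUnit
  have hl : S⁻¹ l l = 0 := by
    refine hpos.eq_zero_of_path_of_bridges hS p hp
      (fun u v he => SimpleGraph.Walk.not_reachable_deleteEdges_of_unique
        (fun q hq => huniq q p hq hp) he)
      (x := fun i => S⁻¹ i l) (fun i hi => ?_) h0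
    change (S * S⁻¹) i l = 0
    rw [mul_nonsing_inv _ hdet, one_apply_ne hi]
  exact hpos.inv.diag_pos.ne' hl

end Matrix

/-- If for every non-edge `kl` of `G` there is at most one path in `H` from `k` to
`l`, then the Gaussian double Markovian model `M(G,H)` is connected in the Euclidean
topology on the space of real symmetric matrices. -/
theorem doubleMarkov_connected_of_uniquePaths {n : ℕ} (G H : SimpleGraph (Fin n))
    (huniq : ∀ k l : Fin n, k ≠ l → ¬ G.Adj k l →
      ∀ p q : H.Walk k l, p.IsPath → q.IsPath → p = q) :
    IsConnected {S : Matrix (Fin n) (Fin n) ℝ | S.PosDef ∧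
      (∀ i j : Fin n, i ≠ j → ¬ G.Adj i j → S⁻¹ i j = 0) ∧
      (∀ i j : Fin n, i ≠ j → ¬ H.Adj i j → S i j = 0)} := by
  refine IsPathConnected.isConnected (StarConvex.isPathConnected (a := 1) ?_ ?_)
  · rintro S ⟨hpos, hG, hH⟩ a b ha hb hab
    have hS : S.IsSymm := hpos.isHermitian
    have hTpos : (a • (1 : Matrix (Fin n) (Fin n) ℝ) + b • S).PosDef := by
      rcases hb.eq_or_lt with rfl | hb
      · obtain rfl : a = 1 := by linarith
        simpa using Matrix.PosDef.one
      · exact Matrix.PosDef.posSemidef_add (Matrix.PosSemidef.one.smul ha) (hpos.smul hb)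
    have hT : (a • (1 : Matrix (Fin n) (Fin n) ℝ) + b • S).IsSymm := hTpos.isHermitian
    have happ : ∀ i j, i ≠ j →
        (a • (1 : Matrix (Fin n) (Fin n) ℝ) + b • S) i j = b * S i j := by
      intro i j hij
      simp [Matrix.one_apply_ne hij]
    have hle : Matrix.supportGraph _ hT ≤ S.supportGraph hS := fun i j h =>
      ⟨h.1, fun h0 => h.2 (by rw [happ i j h.1, h0, mul_zero])⟩
    have hleH : S.supportGraph hS ≤ H := fun i j h => by
      by_contra hn
      exact h.2 (hH i j h.1 hn)
    refine ⟨hTpos, fun i j hij hn => ?_, fun i j hij hn => ?_⟩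
    · refine Matrix.inv_apply_eq_zero_of_not_reachable hT hTpos.det_pos.ne'.isUnit fun hr => ?_
      refine hpos.inv_apply_ne_zero_of_unique_path_s8 hS (hr.mono hle) (fun p q hp hq => ?_)
        (hG i j hij hn)
      exact SimpleGraph.Walk.map_injective_of_injective (f := SimpleGraph.Hom.ofLE hleH)
        Function.injective_id i j
        (huniq i j hij hn _ _ (hp.mapLe hleH) (hq.mapLe hleH))
    · rw [happ i j hij, hH i j hij hn, mul_zero]
  · refine ⟨Matrix.PosDef.one, fun i j hij _ => ?_, fun i j hij _ => Matrix.one_apply_ne hij⟩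
    rw [inv_one, Matrix.one_apply_ne hij]
end

section
/- Let G and H be simple graphs on N = {1,…,n} and suppose there exists a vertex i ∈ N such that for every pair k ≠ l with {k,l} ∉ E_G, every path in H from k to l passes through i. Then the set M(G,H), viewed as a subset of the space of real symmetric n×n matrices with the Euclidean topology, is connected. -/
open Matrix

/-- If the off-diagonal support of an invertible matrix `S` lies in a graph `H`, then `S⁻¹`
vanishes between vertices in different connected components of `H`. -/
lemma Matrix.inv_apply_eq_zero_of_not_reachable_s9 {V : Type*} [Fintype V] [DecidableEq V]
    {S : Matrix V V ℝ} (hS : IsUnit S.det) {H : SimpleGraph V}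
    (hH : ∀ a b, a ≠ b → ¬ H.Adj a b → S a b = 0) {j l : V} (hjl : ¬ H.Reachable j l) :
    S⁻¹ j l = 0 := by
  classical
  let X : Matrix V V ℝ := diagonal fun a => if H.Reachable j a then 1 else 0
  have hcomm : X * S = S * X := by
    ext a b
    simp only [X, diagonal_mul, mul_diagonal]
    rcases eq_or_ne a b with rfl | hab
    · ring
    by_cases hadj : H.Adj a b
    · have : H.Reachable j a ↔ H.Reachable j b :=
        ⟨fun h => h.trans hadj.reachable, fun h => h.trans hadj.symm.reachable⟩
      simp [this]
    · simp [hH a b hab hadj]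
  have hinv : S⁻¹ * X = X * S⁻¹ := by
    calc S⁻¹ * X = S⁻¹ * (X * S) * S⁻¹ := by
          rw [Matrix.mul_assoc, Matrix.mul_assoc, Matrix.mul_nonsing_inv _ hS, Matrix.mul_one]
      _ = X * S⁻¹ := by
          rw [hcomm, ← Matrix.mul_assoc, Matrix.nonsing_inv_mul _ hS, Matrix.one_mul]
  have h := congrFun (congrFun hinv j) l
  simpa [X, diagonal_mul, mul_diagonal, hjl] using h.symm

/-- Two distinct vertices joined by a walk avoiding `i` are adjacent in `G`, if `i` lies on
every path of `H` joining a non-edge of `G`. -/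
lemma SimpleGraph.adj_of_reachable_deleteIncidenceSet {V : Type*} {G H : SimpleGraph V} {i : V}
    (hi : ∀ k l : V, k ≠ l → ¬ G.Adj k l → ∀ p : H.Walk k l, p.IsPath → i ∈ p.support)
    {k l : V} (hkl : k ≠ l) (hr : (H.deleteIncidenceSet i).Reachable k l) : G.Adj k l := by
  classical
  by_contra hG
  have hl : l ≠ i := by
    obtain ⟨q⟩ := hr.symm
    cases q with
    | nil => exact absurd rfl hkl
    | cons h _ => exact (SimpleGraph.deleteIncidenceSet_adj.1 h).2.1
  have key : ∀ {a b : V}, b ≠ i →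
      ∀ p : (H.deleteIncidenceSet i).Walk a b, i ∉ p.support := by
    intro a b hb p
    induction p with
    | nil => simpa using hb.symm
    | cons h q ih =>
      rw [SimpleGraph.Walk.support_cons, List.mem_cons, not_or]
      exact ⟨(SimpleGraph.deleteIncidenceSet_adj.1 h).2.1.symm, ih hb⟩
  obtain ⟨p, hp⟩ := hr.exists_isPath
  refine key hl p ?_
  have := hi k l hkl hG (p.mapLe (H.deleteIncidenceSet_le i)) (hp.mapLe _)
  simpa using this

/-- Scaling the off-diagonal part of row and column `i` of `S` by `ε` while keeping the
Schur complement `((S⁻¹) i i)⁻¹` fixed. -/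
noncomputable def Matrix.shrinkVertex {V : Type*} [Fintype V] [DecidableEq V]
    (S : Matrix V V ℝ) (i : V) (ε : ℝ) : Matrix V V ℝ :=
  (1 - (1 - ε) • single i i 1) * S * (1 - (1 - ε) • single i i 1) +
    ((1 - ε ^ 2) * (S⁻¹ i i)⁻¹) • single i i 1

namespace Matrix

variable {V : Type*} [Fintype V] [DecidableEq V]

lemma shrinkVertex_apply_of_ne (S : Matrix V V ℝ) (i : V) (ε : ℝ) {j l : V} (h : j ≠ l) :
    S.shrinkVertex i ε j l = (if j = i ∨ l = i then ε else 1) * S j l := by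
  have hd : (1 - (1 - ε) • single i i 1 : Matrix V V ℝ) =
      diagonal fun a => if a = i then ε else 1 := by
    ext a b
    simp only [sub_apply, smul_apply, single_apply, one_apply, diagonal_apply, smul_eq_mul]
    grind
  rw [shrinkVertex, hd, add_apply, mul_diagonal, diagonal_mul, smul_apply, single_apply, smul_eq_mul]
  grind

lemma continuous_shrinkVertex (S : Matrix V V ℝ) (i : V) : Continuous (S.shrinkVertex i) := by
  unfold shrinkVertex
  fun_prop

lemma shrinkVertex_one (S : Matrix V V ℝ) (i : V) : S.shrinkVertex i 1 = S := by
  simp [shrinkVertex]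

lemma PosDef.shrinkVertex {S : Matrix V V ℝ} (hS : S.PosDef) (i : V) {ε : ℝ}
    (h0 : 0 ≤ ε) (h1 : ε ≤ 1) : (S.shrinkVertex i ε).PosDef := by
  have hk : 0 < (S⁻¹ i i)⁻¹ := inv_pos.2 hS.inv.diag_pos
  set D : Matrix V V ℝ := 1 - (1 - ε) • single i i 1 with hD
  have hDH : Dᴴ = D := by simp [hD]
  have hDS : (D * S * D).PosSemidef := by
    have := hS.posSemidef.conjTranspose_mul_mul_same D
    rwa [hDH] at this
  have hEpos : (single i i (1 : ℝ)).PosSemidef := by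
    have := posSemidef_conjTranspose_mul_self (single i i (1 : ℝ))
    simpa using this
  rcases h1.eq_or_lt with rfl | h1
  · rwa [shrinkVertex_one]
  have hc : 0 < (1 - ε ^ 2) * (S⁻¹ i i)⁻¹ := mul_pos (by nlinarith) hk
  refine PosDef.of_dotProduct_mulVec_pos (hDS.add (hEpos.smul hc.le)).isHermitian fun x hx => ?_
  have hDx : star x ⬝ᵥ ((D * S * D) *ᵥ x) = star (D *ᵥ x) ⬝ᵥ (S *ᵥ (D *ᵥ x)) := by
    rw [star_mulVec, hDH, ← dotProduct_mulVec, mulVec_mulVec, mulVec_mulVec, Matrix.mul_assoc]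
  have hEx : star x ⬝ᵥ ((single i i (1 : ℝ)) *ᵥ x) = x i ^ 2 := by
    rw [single_mulVec, one_mul, sq]
    exact dotProduct_single (star x) (x i) i
  rw [Matrix.shrinkVertex, ← hD, add_mulVec, dotProduct_add, hDx, smul_mulVec, dotProduct_smul,
    hEx, smul_eq_mul]
  by_cases hxi : x i = 0
  · have hDxx : D *ᵥ x = x := by
      simp [hD, sub_mulVec, single_mulVec, hxi]
    rw [hDxx, hxi]
    simpa using hS.dotProduct_mulVec_pos hx
  · have := hS.posSemidef.dotProduct_mulVec_nonneg (D *ᵥ x)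
    positivity

lemma single_mul_mul_single_self (A : Matrix V V ℝ) (i : V) :
    single i i 1 * (A * single i i 1) = A i i • single i i (1 : ℝ) := by
  ext a b
  rw [← Matrix.mul_assoc]
  simp [single_apply]

lemma inv_shrinkVertex {S : Matrix V V ℝ} (hS : S.PosDef) (i : V) (ε : ℝ) :
    (S.shrinkVertex i ε)⁻¹ = S⁻¹ - ((1 - ε ^ 2) * (S⁻¹ i i)⁻¹) • (S⁻¹ * (single i i 1 * S⁻¹))
      + (ε * (1 - ε)) • (S⁻¹ * single i i 1 + single i i 1 * S⁻¹)
      + ((1 - ε) ^ 2 * S⁻¹ i i) • single i i 1 := by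
  have hk : S⁻¹ i i ≠ 0 := hS.inv.diag_pos.ne'
  have hdet : IsUnit S.det := (isUnit_iff_isUnit_det S).1 hS.isUnit
  apply inv_eq_right_inv
  unfold shrinkVertex
  have hSK : S * S⁻¹ = 1 := mul_nonsing_inv S hdet
  have hEKE := single_mul_mul_single_self S⁻¹ i
  have hEE : single i i (1 : ℝ) * single i i 1 = single i i 1 := by simp
  generalize single i i (1 : ℝ) = E at *
  generalize S⁻¹ i i = k at *
  generalize S⁻¹ = K at *
  have hSK' (X : Matrix V V ℝ) : S * (K * X) = X := by rw [← Matrix.mul_assoc, hSK, one_mul]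
  have hEE' (X : Matrix V V ℝ) : E * (E * X) = E * X := by rw [← Matrix.mul_assoc, hEE]
  have hEKE' (X : Matrix V V ℝ) : E * (K * (E * X)) = k • (E * X) := by
    rw [← Matrix.mul_assoc K, ← Matrix.mul_assoc E, hEKE, smul_mul_assoc]
  simp only [Matrix.mul_add, Matrix.add_mul, Matrix.mul_sub, Matrix.sub_mul, Matrix.mul_smul,
    Matrix.smul_mul, Matrix.mul_assoc, Matrix.one_mul, Matrix.mul_one, hSK, hSK', hEE, hEE',
    hEKE, hEKE', smul_add, smul_sub]
  match_scalars <;> field_simp <;> ring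

/-- Off-diagonal entries of the inverse of `S.shrinkVertex i ε`. -/
lemma inv_shrinkVertex_apply {S : Matrix V V ℝ} (hS : S.PosDef) (i : V) (ε : ℝ) {j l : V}
    (h : j ≠ l) : (S.shrinkVertex i ε)⁻¹ j l = if j = i ∨ l = i then ε * S⁻¹ j l else
      S⁻¹ j l - (1 - ε ^ 2) * (S⁻¹ i i)⁻¹ * (S⁻¹ j i * S⁻¹ i l) := by
  have hk : S⁻¹ i i ≠ 0 := hS.inv.diag_pos.ne'
  have hKE (a b : V) : (S⁻¹ * single i i (1 : ℝ)) a b = if b = i then S⁻¹ a i else 0 := by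
    split_ifs with hb
    · subst hb; simp
    · simp [hb]
  have hEK (a b : V) : (single i i (1 : ℝ) * S⁻¹) a b = if a = i then S⁻¹ i b else 0 := by
    split_ifs with ha
    · subst ha; simp
    · simp [ha]
  have hKEK : (S⁻¹ * (single i i (1 : ℝ) * S⁻¹)) j l = S⁻¹ j i * S⁻¹ i l := by
    simp [mul_apply (M := S⁻¹), hEK]
  rw [inv_shrinkVertex hS]
  simp only [add_apply, sub_apply, smul_apply, smul_eq_mul, hKE, hEK, hKEK, single_apply]
  by_cases hj : j = i
  · subst hj
    simp only [h, h.symm, true_or, if_true, if_false, and_false]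
    field_simp
    ring
  by_cases hl : l = i
  · subst hl
    simp only [h, h.symm, or_true, if_true, if_false, false_and]
    field_simp
    ring
  · simp [hj, hl, Ne.symm hj]

end Matrix

/-- If there is a vertex `i` such that for every non-edge `kl` of `G` every path in
`H` from `k` to `l` passes through `i`, then the Gaussian double Markovian model
`M(G,H)` is connected in the Euclidean topology. -/
theorem doubleMarkov_connected_of_cutVertex {n : ℕ} (G H : SimpleGraph (Fin n))
    (hvert : ∃ i : Fin n, ∀ k l : Fin n, k ≠ l → ¬ G.Adj k l →
      ∀ p : H.Walk k l, p.IsPath → i ∈ p.support) :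
    IsConnected {S : Matrix (Fin n) (Fin n) ℝ | S.PosDef ∧
      (∀ i j : Fin n, i ≠ j → ¬ G.Adj i j → S⁻¹ i j = 0) ∧
      (∀ i j : Fin n, i ≠ j → ¬ H.Adj i j → S i j = 0)} := by
  obtain ⟨i, hi⟩ := hvert
  set M := {S : Matrix (Fin n) (Fin n) ℝ | S.PosDef ∧
      (∀ i j : Fin n, i ≠ j → ¬ G.Adj i j → S⁻¹ i j = 0) ∧
      (∀ i j : Fin n, i ≠ j → ¬ H.Adj i j → S i j = 0)}
  let C := {S : Matrix (Fin n) (Fin n) ℝ | S.PosDef ∧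
      ∀ j l : Fin n, j ≠ l → ¬ (H.deleteIncidenceSet i).Adj j l → S j l = 0}
  have hinv {S : Matrix (Fin n) (Fin n) ℝ} (hS : S ∈ C) {j l : Fin n} (hjl : j ≠ l)
      (hG : ¬ G.Adj j l) : S⁻¹ j l = 0 :=
    Matrix.inv_apply_eq_zero_of_not_reachable_s9 ((isUnit_iff_isUnit_det S).1 hS.1.isUnit) hS.2
      fun hr => hG (SimpleGraph.adj_of_reachable_deleteIncidenceSet hi hjl hr)
  have hCM : C ⊆ M := fun S hS => ⟨hS.1, fun j l hjl hG => hinv hS hjl hG,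
    fun j l hjl hH => hS.2 j l hjl fun h => hH (H.deleteIncidenceSet_le i h)⟩
  have hC1 : (1 : Matrix (Fin n) (Fin n) ℝ) ∈ C :=
    ⟨Matrix.PosDef.one, fun j l hjl _ => Matrix.one_apply_ne hjl⟩
  have hCconv : Convex ℝ C := by
    refine convex_iff_forall_pos.2 fun A hA B hB a b ha hb _ => ⟨?_, fun j l hjl hH => ?_⟩
    · exact (hA.1.smul ha).add (hB.1.smul hb)
    · simp [hA.2 j l hjl hH, hB.2 j l hjl hH]
  refine ⟨⟨1, hCM hC1⟩, isPreconnected_of_forall 1 fun S hS => ?_⟩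
  have hS0 : S.shrinkVertex i 0 ∈ C := by
    refine ⟨hS.1.shrinkVertex i le_rfl zero_le_one, fun j l hjl hH => ?_⟩
    rw [Matrix.shrinkVertex_apply_of_ne S i 0 hjl]
    split_ifs with h
    · simp
    · rw [not_or] at h
      rw [one_mul]
      exact hS.2.2 j l hjl fun hadj => hH (SimpleGraph.deleteIncidenceSet_adj.2 ⟨hadj, h⟩)
  have hpath : S.shrinkVertex i '' Set.Icc 0 1 ⊆ M := by
    rintro _ ⟨ε, ⟨h0, h1⟩, rfl⟩
    refine ⟨hS.1.shrinkVertex i h0 h1, fun j l hjl hG => ?_, fun j l hjl hH => ?_⟩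
    · rw [Matrix.inv_shrinkVertex_apply hS.1 i ε hjl]
      have h := hinv hS0 hjl hG
      rw [Matrix.inv_shrinkVertex_apply hS.1 i 0 hjl] at h
      rw [hS.2.1 j l hjl hG] at h ⊢
      split_ifs at h ⊢
      · ring
      · linear_combination (1 - ε ^ 2) * h
    · rw [Matrix.shrinkVertex_apply_of_ne S i ε hjl, hS.2.2 j l hjl hH, mul_zero]
  refine ⟨S.shrinkVertex i '' Set.Icc 0 1 ∪ C, Set.union_subset hpath hCM, Or.inr hC1,
    Or.inl ⟨1, ⟨zero_le_one, le_rfl⟩, S.shrinkVertex_one i⟩, ?_⟩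
  exact (isPreconnected_Icc.image _ (S.continuous_shrinkVertex i).continuousOn).union
    (S.shrinkVertex i 0) ⟨0, ⟨le_rfl, zero_le_one⟩, rfl⟩ hS0 hCconv.isPreconnected
end

section
/- Let G and H be simple graphs on N = {1,…,n} with E_G ∩ E_H = {{i,j}} consisting of a single edge. Then M(G,H) equals the set of all real symmetric positive definite n×n matrices Σ such that Σ_{ab} = 0 for all a ≠ b with {a,b} ≠ {i,j}. -/
open Matrix in
/-- If row `a` of a positive definite matrix and column `a` of its inverse have no common
off-diagonal support, then row `a` of the matrix vanishes off the diagonal. -/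
theorem Matrix.PosDef.apply_eq_zero_of_forall_mul_inv_eq_zero {m : Type*} [Fintype m]
    [DecidableEq m] {A : Matrix m m ℝ} (hA : A.PosDef) {a : m}
    (h : ∀ b, b ≠ a → A a b * A⁻¹ b a = 0) {b : m} (hb : b ≠ a) : A a b = 0 := by
  have hdet : IsUnit A.det := (Matrix.isUnit_iff_isUnit_det A).1 hA.isUnit
  have hdiag : A a a * A⁻¹ a a = 1 := by
    have h1 := congrFun (congrFun (Matrix.mul_nonsing_inv A hdet) a) a
    rwa [Matrix.mul_apply, Finset.sum_eq_single a (fun c _ hc => h c hc) (by simp),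
      Matrix.one_apply_eq] at h1
  have hsymm (c d : m) : A c d = A d c := by simpa using hA.isHermitian.apply d c
  set e : m → ℝ := Pi.single a 1 with he
  set v : m → ℝ := A *ᵥ e - A a a • e with hv
  have hKv : A⁻¹ *ᵥ v = e - A a a • (A⁻¹ *ᵥ e) := by
    rw [hv, Matrix.mulVec_sub, Matrix.mulVec_mulVec, Matrix.nonsing_inv_mul A hdet,
      Matrix.one_mulVec, Matrix.mulVec_smul]
  have hva : v a = 0 := by simp [hv, he]
  have hAKv : v ⬝ᵥ (A⁻¹ *ᵥ e) = 0 := by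
    have hT : (A⁻¹)ᵀ = A⁻¹ := by simpa using hA.inv.isHermitian.eq
    rw [Matrix.dotProduct_mulVec, ← Matrix.mulVec_transpose, hT, hKv, he]
    simp [hdiag]
  have hv0 : v = 0 := by
    by_contra hne
    have hpos := hA.inv.dotProduct_mulVec_pos hne
    rw [star_trivial, hKv, dotProduct_sub, dotProduct_smul, hAKv, he] at hpos
    simp [hva] at hpos
  have hvb := congrFun hv0 b
  rw [hsymm]
  simpa [hv, he, hb] using hvb


/-- If `E_G ∩ E_H = {ij}` consists of a single edge, then `M(G,H) = PD_{ij}`: it is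
the set of positive definite matrices all of whose off-diagonal entries outside
positions `(i,j)` and `(j,i)` vanish. -/
theorem doubleMarkov_single_common_edge {n : ℕ} (G H : SimpleGraph (Fin n))
    (i j : Fin n) (hij : i ≠ j)
    (hcap : G.edgeSet ∩ H.edgeSet = {s(i, j)}) :
    {S : Matrix (Fin n) (Fin n) ℝ | S.PosDef ∧
        (∀ a b : Fin n, a ≠ b → ¬ G.Adj a b → S⁻¹ a b = 0) ∧
        (∀ a b : Fin n, a ≠ b → ¬ H.Adj a b → S a b = 0)} =
      {S : Matrix (Fin n) (Fin n) ℝ | S.PosDef ∧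
        ∀ a b : Fin n, a ≠ b → ¬ ((a = i ∧ b = j) ∨ (a = j ∧ b = i)) → S a b = 0} := by
  have hmem (a b : Fin n) : (G.Adj a b ∧ H.Adj a b) ↔ (a = i ∧ b = j) ∨ (a = j ∧ b = i) := by
    have h := Set.ext_iff.1 hcap s(a, b)
    simpa using h
  ext S
  refine ⟨fun ⟨hS, hG, hH⟩ => ⟨hS, fun a b hab hne => ?_⟩,
    fun ⟨hS, hz⟩ => ⟨hS, fun a b hab hGab => ?_, fun a b hab hHab => ?_⟩⟩
  · have hsymm (c d : Fin n) : S c d = S d c := by simpa using hS.isHermitian.apply d c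
    have hrow (c : Fin n) (hci : c ≠ i) (hcj : c ≠ j) (d : Fin n) (hd : d ≠ c) : S c d = 0 := by
      refine hS.apply_eq_zero_of_forall_mul_inv_eq_zero (fun k hk => ?_) hd
      by_cases hHck : H.Adj c k
      · rw [hG k c hk fun hGkc => ?_, mul_zero]
        have := (hmem c k).1 ⟨hGkc.symm, hHck⟩
        tauto
      · rw [hH c k hk.symm hHck, zero_mul]
    by_cases ha : a ≠ i ∧ a ≠ j
    · exact hrow a ha.1 ha.2 b hab.symm
    · rw [hsymm]
      exact hrow b (by grind) (by grind) a hab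
  · have hK := hS.inv
    have hdet : IsUnit S.det := (Matrix.isUnit_iff_isUnit_det S).1 hS.isUnit
    have hsymm (c d : Fin n) : S⁻¹ c d = S⁻¹ d c := by simpa using hK.isHermitian.apply d c
    have hrow (c : Fin n) (hci : c ≠ i) (hcj : c ≠ j) (d : Fin n) (hd : d ≠ c) :
        S⁻¹ c d = 0 := by
      refine hK.apply_eq_zero_of_forall_mul_inv_eq_zero (fun k hk => ?_) hd
      rw [Matrix.nonsing_inv_nonsing_inv S hdet, hz k c hk (by tauto), mul_zero]
    have hne : ¬ ((a = i ∧ b = j) ∨ (a = j ∧ b = i)) := fun h => hGab ((hmem a b).2 h).1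
    by_cases ha : a ≠ i ∧ a ≠ j
    · exact hrow a ha.1 ha.2 b hab.symm
    · rw [hsymm]
      exact hrow b (by grind) (by grind) a hab
  · exact hz a b hab fun h => hHab ((hmem a b).2 h).2
end

section
/- Let G and H be simple graphs on N = {1,…,n} and let i, j, k ∈ N be pairwise distinct with E_G ∩ E_H = {{i,j},{j,k}}. If {i,k} ∈ E_G and {i,k} ∉ E_H, then M(G,H) equals the set of all real symmetric positive definite n×n matrices Σ such that Σ_{ab} = 0 for all a ≠ b with {a,b} ∉ {{i,j},{j,k}} (i.e., M(G,H) is the inverse graphical model of the graph G ∩ H). -/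
open scoped Matrix in
/-- If a column of a positive definite matrix and the same column of its inverse have disjoint
off-diagonal supports, then the column of the matrix is zero off the diagonal. -/
theorem Matrix.PosDef.apply_eq_zero_of_mul_inv_apply_eq_zero {m : Type*} [Fintype m]
    [DecidableEq m] {S : Matrix m m ℝ} (hS : S.PosDef) {a : m}
    (h : ∀ b, b ≠ a → S b a * S⁻¹ b a = 0) {b : m} (hb : b ≠ a) : S b a = 0 := by
  set u : m → ℝ := S.col a - S a a • Pi.single a 1 with hu
  have hinv : S⁻¹ * S = 1 := Matrix.nonsing_inv_mul S ((Matrix.isUnit_iff_isUnit_det S).1 hS.isUnit)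
  have hKu : S⁻¹ *ᵥ u = Pi.single a 1 - S a a • S⁻¹.col a := by
    rw [hu, Matrix.mulVec_sub, Matrix.mulVec_smul, Matrix.mulVec_single_one,
      ← Matrix.mulVec_single_one S, Matrix.mulVec_mulVec, hinv, Matrix.one_mulVec]
  have hdot : u ⬝ᵥ (S⁻¹ *ᵥ u) = 0 := by
    rw [hKu]
    refine Finset.sum_eq_zero fun c _ => ?_
    by_cases hc : c = a
    · subst hc
      simp [hu]
    · have := h c hc
      simp only [hu, Pi.sub_apply, Pi.smul_apply, Matrix.col_apply, Pi.single_apply, if_neg hc,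
        smul_eq_mul]
      linear_combination (-S a a) * this
  have hu0 : u = 0 := by
    by_contra hne
    have := hS.inv.dotProduct_mulVec_pos hne
    rw [star_trivial, hdot] at this
    exact lt_irrefl _ this
  simpa [hu, hb] using congrFun hu0 b

/-- If a row of an invertible matrix is zero off the diagonal, so is that row of its inverse. -/
theorem Matrix.inv_apply_eq_zero_of_row {m : Type*} [Fintype m] [DecidableEq m]
    {S : Matrix m m ℝ} (hS : IsUnit S) {a : m} (h : ∀ b, a ≠ b → S a b = 0) {b : m}
    (hb : a ≠ b) : S⁻¹ a b = 0 := by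
  have hdet := (Matrix.isUnit_iff_isUnit_det S).1 hS
  have key (c : m) : S a a * S⁻¹ a c = (1 : Matrix m m ℝ) a c := by
    rw [← Matrix.mul_nonsing_inv S hdet, Matrix.mul_apply, Finset.sum_eq_single a]
    · exact fun d _ hd => by rw [h d hd.symm, zero_mul]
    · exact fun ha => (ha (Finset.mem_univ a)).elim
  have h1 := key a
  have h2 := key b
  rw [Matrix.one_apply_eq] at h1
  rw [Matrix.one_apply_ne hb] at h2
  exact (mul_eq_zero.1 h2).resolve_left (left_ne_zero_of_mul_eq_one h1)

/-- If `E_G ∩ E_H = {ij, jk}` is a path of two edges and `ik ∈ E_G ∖ E_H`, then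
`M(G,H)` is the inverse graphical model of `G ∩ H`: the set of positive definite
matrices whose off-diagonal support is contained in `{ij, jk}`. -/
theorem doubleMarkov_two_common_edges_inverse_graphical {n : ℕ}
    (G H : SimpleGraph (Fin n)) (i j k : Fin n)
    (hij : i ≠ j) (hjk : j ≠ k) (hik : i ≠ k)
    (hcap : G.edgeSet ∩ H.edgeSet = {s(i, j), s(j, k)})
    (hG : G.Adj i k) (hH : ¬ H.Adj i k) :
    {S : Matrix (Fin n) (Fin n) ℝ | S.PosDef ∧
        (∀ a b : Fin n, a ≠ b → ¬ G.Adj a b → S⁻¹ a b = 0) ∧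
        (∀ a b : Fin n, a ≠ b → ¬ H.Adj a b → S a b = 0)} =
      {S : Matrix (Fin n) (Fin n) ℝ | S.PosDef ∧
        ∀ a b : Fin n, a ≠ b →
          ¬ (s(a, b) = s(i, j) ∨ s(a, b) = s(j, k)) → S a b = 0} := by
  have hGH (a b : Fin n) : (G.Adj a b ∧ H.Adj a b) ↔ (s(a, b) = s(i, j) ∨ s(a, b) = s(j, k)) := by
    simpa using Set.ext_iff.1 hcap s(a, b)
  have hGij : G.Adj i j := ((hGH i j).2 (Or.inl rfl)).1
  have hGjk : G.Adj j k := ((hGH j k).2 (Or.inr rfl)).1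
  ext S
  refine ⟨fun ⟨hS, hK, hSH⟩ => ⟨hS, ?_⟩, fun ⟨hS, hz⟩ => ⟨hS, ?_, ?_⟩⟩
  · have hsymm (a b : Fin n) : S a b = S b a := by simpa using hS.isHermitian.apply b a
    have hout (a b : Fin n) (hai : a ≠ i) (haj : a ≠ j) (hak : a ≠ k) (hb : b ≠ a) :
        S b a = 0 := by
      refine hS.apply_eq_zero_of_mul_inv_apply_eq_zero (fun c hc => ?_) hb
      by_cases hcG : G.Adj c a
      · have hcH : ¬ H.Adj c a := fun hcH => by
          have := (hGH c a).1 ⟨hcG, hcH⟩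
          simp only [Sym2.eq_iff] at this
          tauto
        rw [hSH c a hc hcH, zero_mul]
      · rw [hK c a hc hcG, mul_zero]
    intro a b hab hne
    by_cases ha : a = i ∨ a = j ∨ a = k
    · by_cases hb : b = i ∨ b = j ∨ b = k
      · rcases ha with rfl | rfl | rfl <;> rcases hb with rfl | rfl | rfl <;>
          simp_all [Sym2.eq_swap, SimpleGraph.adj_comm]
      · push Not at hb
        exact hout b a hb.1 hb.2.1 hb.2.2 hab
    · push Not at ha
      rw [hsymm]
      exact hout a b ha.1 ha.2.1 ha.2.2 hab.symm
  · have hsymm (a b : Fin n) : S⁻¹ a b = S⁻¹ b a := by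
      simpa using hS.inv.isHermitian.apply b a
    have hout (a b : Fin n) (hai : a ≠ i) (haj : a ≠ j) (hak : a ≠ k) (hb : a ≠ b) :
        S⁻¹ a b = 0 := by
      refine Matrix.inv_apply_eq_zero_of_row hS.isUnit (fun c hc => hz a c hc ?_) hb
      simp only [Sym2.eq_iff]
      tauto
    intro a b hab hnG
    by_cases ha : a = i ∨ a = j ∨ a = k
    · by_cases hb : b = i ∨ b = j ∨ b = k
      · have := hGij.symm
        have := hGjk.symm
        have := hG.symm
        rcases ha with rfl | rfl | rfl <;> rcases hb with rfl | rfl | rfl <;> contradiction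
      · push Not at hb
        rw [hsymm]
        exact hout b a hb.1 hb.2.1 hb.2.2 hab.symm
    · push Not at ha
      exact hout a b ha.1 ha.2.1 ha.2.2 hab
  · exact fun a b hab hnH => hz a b hab fun h => hnH ((hGH a b).2 h).2
end

section
/- Let G and H be simple graphs on N = {1,…,n} and let i, j, k ∈ N be pairwise distinct with E_G ∩ E_H = {{i,j},{i,k},{j,k}} forming a 3-clique. Then M(G,H) equals the set of all real symmetric positive definite n×n matrices Σ such that Σ_{ab} = 0 for all a ≠ b with {a,b} ⊄ {i,j,k}. -/
/-- If `S` is positive definite and `S a a * S⁻¹ a a = 1`, then column `a` of `S` is diagonal. -/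
theorem Matrix.PosDef.apply_eq_zero_of_diag_mul_inv_diag_eq_one {ι : Type*} [Fintype ι]
    [DecidableEq ι] {S : Matrix ι ι ℝ} (hS : S.PosDef) {a b : ι} (h : S a a * S⁻¹ a a = 1)
    (hba : b ≠ a) : S b a = 0 := by
  have hu : IsUnit S.det := (Matrix.isUnit_iff_isUnit_det S).1 hS.isUnit
  set t := S⁻¹ a a with ht
  set v : ι → ℝ := S⁻¹.mulVec (Pi.single a 1) - t • Pi.single a 1 with hv
  have hva : v a = 0 := by simp [hv, ht]
  have hSv : S.mulVec v = Pi.single a 1 - t • S.col a := by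
    rw [hv, Matrix.mulVec_sub, Matrix.mulVec_mulVec, Matrix.mul_nonsing_inv _ hu,
      Matrix.one_mulVec, Matrix.mulVec_smul, Matrix.mulVec_single_one]
  have hSva : S.mulVec v a = 0 := by
    rw [hSv]
    simp
    linarith
  have hcol : v ⬝ᵥ S.col a = S.mulVec v a := by
    simp only [dotProduct, Matrix.mulVec, Matrix.col_apply]
    refine Finset.sum_congr rfl fun c _ => ?_
    rw [← hS.isHermitian.apply a c, star_trivial, mul_comm]
  have hv0 : v = 0 := by
    by_contra hne
    have hpos := hS.dotProduct_mulVec_pos hne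
    rw [star_trivial, hSv, dotProduct_sub, dotProduct_smul, hcol, hSva] at hpos
    simp [hva] at hpos
  have hb := congrFun hSv b
  have ht0 : t ≠ 0 := right_ne_zero_of_mul_eq_one h
  rw [hv0] at hb
  simpa [hba, ht0] using hb

/-- If column `a` of a positive definite matrix is diagonal, then so is column `a` of its
inverse. -/
theorem Matrix.PosDef.inv_apply_eq_zero_of_forall_apply_eq_zero {ι : Type*} [Fintype ι]
    [DecidableEq ι] {S : Matrix ι ι ℝ} (hS : S.PosDef) {a b : ι}
    (h : ∀ c, c ≠ a → S c a = 0) (hba : b ≠ a) : S⁻¹ b a = 0 := by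
  have hu : IsUnit S.det := (Matrix.isUnit_iff_isUnit_det S).1 hS.isUnit
  have hmul := congrFun (congrFun (Matrix.nonsing_inv_mul S hu) b) a
  rw [Matrix.mul_apply, Finset.sum_eq_single a (fun c _ hc => by rw [h c hc, mul_zero])
    (by simp), Matrix.one_apply_ne hba] at hmul
  exact (mul_eq_zero.1 hmul).resolve_right (ne_of_gt hS.diag_pos)


/-- If `E_G ∩ E_H = {ij, ik, jk}` forms a 3-clique, then `M(G,H) = PD_{ijk}`: it is
the set of positive definite matrices whose off-diagonal entries vanish outside the
principal block indexed by `{i,j,k}`. -/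
theorem doubleMarkov_three_clique {n : ℕ} (G H : SimpleGraph (Fin n))
    (i j k : Fin n) (hij : i ≠ j) (hjk : j ≠ k) (hik : i ≠ k)
    (hcap : G.edgeSet ∩ H.edgeSet = {s(i, j), s(i, k), s(j, k)}) :
    {S : Matrix (Fin n) (Fin n) ℝ | S.PosDef ∧
        (∀ a b : Fin n, a ≠ b → ¬ G.Adj a b → S⁻¹ a b = 0) ∧
        (∀ a b : Fin n, a ≠ b → ¬ H.Adj a b → S a b = 0)} =
      {S : Matrix (Fin n) (Fin n) ℝ | S.PosDef ∧
        ∀ a b : Fin n, a ≠ b →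
          ¬ (a ∈ ({i, j, k} : Set (Fin n)) ∧ b ∈ ({i, j, k} : Set (Fin n))) →
          S a b = 0} := by
  have hadj : ∀ a b : Fin n, G.Adj a b ∧ H.Adj a b ↔
      a ≠ b ∧ a ∈ ({i, j, k} : Set (Fin n)) ∧ b ∈ ({i, j, k} : Set (Fin n)) := by
    intro a b
    have h := Set.ext_iff.1 hcap s(a, b)
    simp only [Set.mem_inter_iff, SimpleGraph.mem_edgeSet, Set.mem_insert_iff,
      Set.mem_singleton_iff, Sym2.eq_iff] at h ⊢
    rw [h]
    grind
  ext S
  refine and_congr_right fun hS => ⟨fun ⟨hG, hH⟩ => ?_, fun h => ?_⟩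
  · have key : ∀ a b : Fin n, b ≠ a → a ∉ ({i, j, k} : Set (Fin n)) → S b a = 0 := by
      intro a b hba ha
      refine hS.apply_eq_zero_of_diag_mul_inv_diag_eq_one ?_ hba
      have hu : IsUnit S.det := (Matrix.isUnit_iff_isUnit_det S).1 hS.isUnit
      have hmul := congrFun (congrFun (Matrix.mul_nonsing_inv S hu) a) a
      rwa [Matrix.mul_apply, Finset.sum_eq_single a _ (by simp), Matrix.one_apply_eq] at hmul
      intro c _ hca
      by_cases hHac : H.Adj a c
      · have hGca : ¬ G.Adj c a := fun hg => ha ((hadj a c).1 ⟨hg.symm, hHac⟩).2.1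
        rw [hG c a hca hGca, mul_zero]
      · rw [hH a c hca.symm hHac, zero_mul]
    intro a b hab hmem
    rcases not_and_or.1 hmem with ha | hb
    · rw [← hS.isHermitian.apply a b, key a b hab.symm ha, star_zero]
    · exact key b a hab hb
  · refine ⟨fun a b hab hnot => ?_, fun a b hab hnot => h a b hab fun hmem =>
      hnot ((hadj a b).2 ⟨hab, hmem⟩).2⟩
    have hmem := fun hmem => hnot ((hadj a b).2 ⟨hab, hmem⟩).1
    rcases not_and_or.1 hmem with ha | hb
    · rw [← hS.isHermitian.inv.apply a b, hS.inv_apply_eq_zero_of_forall_apply_eq_zero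
        (fun c hc => h c a hc fun hm => ha hm.2) hab.symm, star_zero]
    · exact hS.inv_apply_eq_zero_of_forall_apply_eq_zero
        (fun c hc => h c b hc fun hm => hb hm.2) hab
end

section
/- Let G and H be simple graphs on N = {1,…,n} with |E_G ∩ E_H| ≤ 3. Then the set M(G,H), viewed as a subset of the space of real symmetric n×n matrices with the Euclidean topology, is connected. -/
open Matrix

/-- The Gaussian double Markovian model of a pair of graphs on a finite vertex set. -/
def doubleMarkov {V : Type*} [Fintype V] [DecidableEq V] (G H : SimpleGraph V) :
    Set (Matrix V V ℝ) :=
  {S | S.PosDef ∧ (∀ i j, i ≠ j → ¬ G.Adj i j → S⁻¹ i j = 0) ∧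
    (∀ i j, i ≠ j → ¬ H.Adj i j → S i j = 0)}

section General

variable {V W : Type*} [Fintype V] [DecidableEq V] [Fintype W] [DecidableEq W]

theorem Matrix.PosDef.inv_inv {S : Matrix V V ℝ} (hS : S.PosDef) : S⁻¹⁻¹ = S :=
  Matrix.nonsing_inv_nonsing_inv S ((Matrix.isUnit_iff_isUnit_det S).1 hS.isUnit)

theorem Matrix.PosDef.apply_comm {ι : Type*} {S : Matrix ι ι ℝ} (hS : S.PosDef) (i j : ι) :
    S i j = S j i := by
  simpa using hS.isHermitian.apply j i

theorem Matrix.PosDef.inv_apply_eq_zero_iff {S : Matrix V V ℝ} (hS : S.PosDef) (i j : V) :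
    S⁻¹ i j = 0 ↔ S.adjugate i j = 0 := by
  have hdet : S.det ≠ 0 := hS.det_pos.ne'
  simp [Matrix.inv_def, Ring.inverse_eq_inv', hdet]

theorem diagonal_mem_doubleMarkov (G H : SimpleGraph V) {d : V → ℝ} (hd : ∀ i, 0 < d i) :
    diagonal d ∈ doubleMarkov G H := by
  refine ⟨Matrix.PosDef.diagonal hd, fun i j hij _ => ?_, fun i j hij _ => diagonal_apply_ne _ hij⟩
  rw [Matrix.inv_diagonal, diagonal_apply_ne _ hij]

theorem doubleMarkov_nonempty (G H : SimpleGraph V) : (doubleMarkov G H).Nonempty :=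
  ⟨_, diagonal_mem_doubleMarkov G H (d := 1) fun _ => one_pos⟩

theorem convex_posDef {ι : Type*} : Convex ℝ {S : Matrix ι ι ℝ | S.PosDef} := by
  rw [convex_iff_forall_pos]
  intro A hA B hB a b ha hb _
  exact (Matrix.PosDef.smul hA ha).add (Matrix.PosDef.smul hB hb)

theorem isConnected_doubleMarkov_of_complete_left {G H : SimpleGraph V}
    (hG : ∀ i j, i ≠ j → G.Adj i j) : IsConnected (doubleMarkov G H) := by
  refine Convex.isConnected ?_ (doubleMarkov_nonempty G H)
  rw [convex_iff_forall_pos]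
  intro A hA B hB a b ha hb hab
  refine ⟨convex_posDef hA.1 hB.1 ha.le hb.le hab, fun i j hij h => absurd (hG i j hij) h,
    fun i j hij h => ?_⟩
  simp [hA.2.2 i j hij h, hB.2.2 i j hij h]

theorem inv_mem_doubleMarkov {G H : SimpleGraph V} {S : Matrix V V ℝ} (hS : S ∈ doubleMarkov G H) :
    S⁻¹ ∈ doubleMarkov H G :=
  ⟨hS.1.inv, by rw [hS.1.inv_inv]; exact hS.2.2, hS.2.1⟩

theorem continuousOn_inv_doubleMarkov (G H : SimpleGraph V) :
    ContinuousOn (fun S : Matrix V V ℝ => S⁻¹) (doubleMarkov G H) := by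
  intro S hS
  refine (continuousAt_matrix_inv S ?_).continuousWithinAt
  rw [Ring.inverse_eq_inv']
  exact continuousAt_inv₀ hS.1.det_pos.ne'

theorem isConnected_doubleMarkov_swap {G H : SimpleGraph V} (h : IsConnected (doubleMarkov G H)) :
    IsConnected (doubleMarkov H G) := by
  convert h.image _ (continuousOn_inv_doubleMarkov G H)
  ext S
  exact ⟨fun hS => ⟨S⁻¹, inv_mem_doubleMarkov hS, hS.1.inv_inv⟩,
    fun ⟨T, hT, h⟩ => h ▸ inv_mem_doubleMarkov hT⟩

theorem isConnected_doubleMarkov_of_complete_right {G H : SimpleGraph V}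
    (hH : ∀ i j, i ≠ j → H.Adj i j) : IsConnected (doubleMarkov G H) :=
  isConnected_doubleMarkov_swap (isConnected_doubleMarkov_of_complete_left hH)

theorem submatrix_mem_doubleMarkov {G H : SimpleGraph V} (e : W ≃ V) {S : Matrix V V ℝ}
    (hS : S ∈ doubleMarkov G H) : S.submatrix e e ∈ doubleMarkov (G.comap e) (H.comap e) := by
  refine ⟨hS.1.submatrix e.injective, fun i j hij h => ?_,
    fun i j hij h => hS.2.2 _ _ (e.injective.ne hij) h⟩
  rw [Matrix.inv_submatrix_equiv]
  exact hS.2.1 _ _ (e.injective.ne hij) h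

theorem isConnected_doubleMarkov_of_comap {G H : SimpleGraph V} (e : W ≃ V)
    (h : IsConnected (doubleMarkov (G.comap e) (H.comap e))) : IsConnected (doubleMarkov G H) := by
  have hc : Continuous fun S : Matrix W W ℝ => S.submatrix e.symm e.symm :=
    continuous_id.matrix_submatrix _ _
  convert h.image _ hc.continuousOn
  ext S
  refine ⟨fun hS => ⟨_, submatrix_mem_doubleMarkov e hS, by simp⟩, ?_⟩
  rintro ⟨T, hT, rfl⟩
  convert submatrix_mem_doubleMarkov e.symm hT using 2 <;>
  · ext; simp

theorem Matrix.eq_zero_of_trace_mul_mul_mul_eq_zero {P : Matrix V V ℝ} {Q : Matrix W W ℝ}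
    (hP : P.PosDef) (hQ : Q.PosDef) {X : Matrix W V ℝ} (h : (P * (Xᵀ * (Q * X))).trace = 0) :
    X = 0 := by
  open scoped MatrixOrder in
  obtain ⟨R, hR⟩ := CStarAlgebra.nonneg_iff_eq_star_mul_self.1 hP.posSemidef.nonneg
  open scoped MatrixOrder in
  obtain ⟨L, hL⟩ := CStarAlgebra.nonneg_iff_eq_star_mul_self.1 hQ.posSemidef.nonneg
  rw [star_eq_conjTranspose, conjTranspose_eq_transpose_of_trivial] at hR hL
  have h0 : L * X * Rᵀ = 0 := by
    rw [← Matrix.trace_conjTranspose_mul_self_eq_zero_iff, ← h, hR, hL,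
      conjTranspose_eq_transpose_of_trivial, Matrix.mul_assoc Rᵀ, Matrix.trace_mul_comm Rᵀ]
    simp only [transpose_mul, transpose_transpose, Matrix.mul_assoc]
  have h1 : Q * X * P = 0 := by
    rw [hL, hR]
    calc Lᵀ * L * X * (Rᵀ * R) = Lᵀ * (L * X * Rᵀ) * R := by simp only [Matrix.mul_assoc]
      _ = 0 := by rw [h0]; simp
  obtain ⟨p, hp⟩ := hP.isUnit
  obtain ⟨q, hq⟩ := hQ.isUnit
  have h2 := congrArg (fun Y => Q⁻¹ * Y * P⁻¹) h1
  have hQ' := Matrix.nonsing_inv_mul Q ((Matrix.isUnit_iff_isUnit_det Q).1 hQ.isUnit)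
  have hP' := Matrix.mul_nonsing_inv P ((Matrix.isUnit_iff_isUnit_det P).1 hP.isUnit)
  simpa [Matrix.mul_assoc, hP', ← Matrix.mul_assoc Q⁻¹ Q, hQ'] using h2

/-- If no common edge joins the two summands, then the model splits as a block diagonal product. -/
theorem toBlocks₂₁_eq_zero {G H : SimpleGraph (V ⊕ W)}
    (h : ∀ v w, ¬ (G.Adj (.inl v) (.inr w) ∧ H.Adj (.inl v) (.inr w)))
    {S : Matrix (V ⊕ W) (V ⊕ W) ℝ} (hS : S ∈ doubleMarkov G H) : S.toBlocks₂₁ = 0 := by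
  have hK := hS.1.inv
  have hSA : S.toBlocks₁₁.PosDef := hS.1.submatrix Sum.inl_injective
  have hKB : S⁻¹.toBlocks₂₂.PosDef := hK.submatrix Sum.inr_injective
  have hdet := (Matrix.isUnit_iff_isUnit_det S).1 hS.1.isUnit
  have hmul := Matrix.nonsing_inv_mul S hdet
  rw [← fromBlocks_toBlocks S⁻¹, ← fromBlocks_toBlocks S, fromBlocks_multiply, ← fromBlocks_one,
    fromBlocks_toBlocks, fromBlocks_inj] at hmul
  have h21 := hmul.2.2.1
  have hKsymm : S⁻¹.toBlocks₁₂ = S⁻¹.toBlocks₂₁ᵀ := by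
    ext i j; exact hK.apply_comm _ _
  have htr : (S⁻¹.toBlocks₁₂ * S.toBlocks₂₁).trace = 0 := by
    refine Finset.sum_eq_zero fun i _ => Finset.sum_eq_zero fun j _ => ?_
    by_cases hG : G.Adj (.inl i) (.inr j)
    · have := hS.2.2 (.inr j) (.inl i) (by simp) fun hH => h i j ⟨hG, hH.symm⟩
      exact mul_eq_zero_of_right _ this
    · exact mul_eq_zero_of_left (hS.2.1 _ _ (by simp) hG) _
  have hA := (Matrix.isUnit_iff_isUnit_det _).1 hSA.isUnit
  have hK21 : S⁻¹.toBlocks₂₁ = -(S⁻¹.toBlocks₂₂ * S.toBlocks₂₁ * S.toBlocks₁₁⁻¹) := by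
    have := congrArg (· * S.toBlocks₁₁⁻¹) (eq_neg_of_add_eq_zero_left h21)
    simpa [Matrix.mul_assoc, Matrix.mul_nonsing_inv _ hA] using this
  refine Matrix.eq_zero_of_trace_mul_mul_mul_eq_zero hSA.inv hKB ?_
  rw [hKsymm, hK21] at htr
  have e1 : S.toBlocks₁₁⁻¹ᵀ = S.toBlocks₁₁⁻¹ := by ext i j; exact hSA.inv.apply_comm _ _
  have e2 : S⁻¹.toBlocks₂₂ᵀ = S⁻¹.toBlocks₂₂ := by ext i j; exact hKB.apply_comm _ _
  simpa [e1, e2, transpose_mul, Matrix.mul_assoc] using htr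

theorem isConnected_doubleMarkov_sum {G H : SimpleGraph (V ⊕ W)}
    (h : ∀ v w, ¬ (G.Adj (.inl v) (.inr w) ∧ H.Adj (.inl v) (.inr w)))
    (hV : IsConnected (doubleMarkov (G.comap Sum.inl) (H.comap Sum.inl)))
    (hW : IsConnected (doubleMarkov (G.comap Sum.inr) (H.comap Sum.inr))) :
    IsConnected (doubleMarkov G H) := by
  have hc : Continuous fun p : Matrix V V ℝ × Matrix W W ℝ => fromBlocks p.1 0 0 p.2 :=
    continuous_fst.matrix_fromBlocks continuous_const continuous_const continuous_snd
  convert (hV.prod hW).image _ hc.continuousOn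
  ext S
  constructor
  · intro hS
    have h21 := toBlocks₂₁_eq_zero h hS
    have h12 : S.toBlocks₁₂ = 0 := by
      ext i j
      exact (hS.1.apply_comm _ _).trans (congrFun (congrFun h21 j) i)
    have hA : S.toBlocks₁₁.PosDef := hS.1.submatrix Sum.inl_injective
    have hD : S.toBlocks₂₂.PosDef := hS.1.submatrix Sum.inr_injective
    have hSe : fromBlocks S.toBlocks₁₁ 0 0 S.toBlocks₂₂ = S := by
      conv_rhs => rw [← fromBlocks_toBlocks S, h12, h21]
    have hinv : S⁻¹ = fromBlocks S.toBlocks₁₁⁻¹ 0 0 S.toBlocks₂₂⁻¹ := by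
      refine Matrix.inv_eq_left_inv ?_
      conv_lhs => rw [← hSe]
      simp [fromBlocks_multiply, ← fromBlocks_one,
        Matrix.nonsing_inv_mul _ ((Matrix.isUnit_iff_isUnit_det _).1 hA.isUnit),
        Matrix.nonsing_inv_mul _ ((Matrix.isUnit_iff_isUnit_det _).1 hD.isUnit)]
    refine ⟨(S.toBlocks₁₁, S.toBlocks₂₂), ⟨⟨hA, fun i j hij hn => ?_, fun i j hij hn => ?_⟩,
      ⟨hD, fun i j hij hn => ?_, fun i j hij hn => ?_⟩⟩, hSe⟩
    · simpa [hinv] using hS.2.1 (.inl i) (.inl j) (by simpa) hn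
    · exact hS.2.2 (.inl i) (.inl j) (by simpa) hn
    · simpa [hinv] using hS.2.1 (.inr i) (.inr j) (by simpa) hn
    · exact hS.2.2 (.inr i) (.inr j) (by simpa) hn
  · rintro ⟨⟨A, D⟩, ⟨hA, hD⟩, rfl⟩
    have hinv : (fromBlocks A 0 0 D)⁻¹ = fromBlocks A⁻¹ 0 0 D⁻¹ := by
      refine Matrix.inv_eq_left_inv ?_
      simp [fromBlocks_multiply, ← fromBlocks_one,
        Matrix.nonsing_inv_mul _ ((Matrix.isUnit_iff_isUnit_det _).1 hA.1.isUnit),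
        Matrix.nonsing_inv_mul _ ((Matrix.isUnit_iff_isUnit_det _).1 hD.1.isUnit)]
    refine ⟨?_, ?_, ?_⟩
    · refine Matrix.PosDef.of_dotProduct_mulVec_pos ?_ fun x hx => ?_
      · exact Matrix.IsHermitian.fromBlocks hA.1.isHermitian (by simp) hD.1.isHermitian
      · have hsum : star x ⬝ᵥ fromBlocks A 0 0 D *ᵥ x =
            star (x ∘ Sum.inl) ⬝ᵥ A *ᵥ (x ∘ Sum.inl) + star (x ∘ Sum.inr) ⬝ᵥ D *ᵥ (x ∘ Sum.inr) := by
          rw [fromBlocks_mulVec]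
          simp [dotProduct, Fintype.sum_sum_type]
        rw [hsum]
        by_cases hl : x ∘ Sum.inl = 0
        · have hr : x ∘ Sum.inr ≠ 0 := fun hr => hx <| by
            rw [← Sum.elim_comp_inl_inr x, hl, hr]
            ext (_ | _) <;> rfl
          exact add_pos_of_nonneg_of_pos (hA.1.posSemidef.dotProduct_mulVec_nonneg _)
            (hD.1.dotProduct_mulVec_pos hr)
        · exact add_pos_of_pos_of_nonneg (hA.1.dotProduct_mulVec_pos hl)
            (hD.1.posSemidef.dotProduct_mulVec_nonneg _)
    · simp only [hinv]
      rintro (i | i) (j | j) hij hn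
      · exact hA.2.1 i j (by simpa using hij) hn
      · simp
      · simp
      · exact hD.2.1 i j (by simpa using hij) hn
    · rintro (i | i) (j | j) hij hn
      · exact hA.2.2 i j (by simpa using hij) hn
      · simp
      · simp
      · exact hD.2.2 i j (by simpa using hij) hn

/-- Rescale the covariances between the vertex `v` and all other vertices by `t`. -/
def scaleVertex (v : V) (t : ℝ) (S : Matrix V V ℝ) : Matrix V V ℝ :=
  of fun i j => if (i = v ↔ j = v) then S i j else t * S i j

theorem scaleVertex_apply {ι : Type*} [DecidableEq ι] (v : ι) (t : ℝ) (S : Matrix ι ι ℝ) (i j : ι) :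
    scaleVertex v t S i j = if (i = v ↔ j = v) then S i j else t * S i j := rfl

theorem scaleVertex_one {ι : Type*} [DecidableEq ι] (v : ι) (S : Matrix ι ι ℝ) :
    scaleVertex v 1 S = S := by
  ext i j
  simp [scaleVertex]

theorem posDef_scaleVertex (v : V) {t : ℝ} (ht : t ∈ Set.Icc (0 : ℝ) 1) {S : Matrix V V ℝ}
    (hS : S.PosDef) : (scaleVertex v t S).PosDef := by
  set D : Matrix V V ℝ := diagonal fun i => if i = v then -1 else 1 with hD
  have hDD : D * D = 1 := by
    rw [hD, diagonal_mul_diagonal, ← diagonal_one]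
    congr 1
    ext i
    split_ifs <;> simp
  have hflip : (D * S * D).PosDef := by
    have := hS.mul_mul_conjTranspose_same (B := D)
      (Matrix.vecMul_injective_iff_isUnit.2 (IsUnit.of_mul_eq_one _ hDD))
    simpa [hD] using this
  have hmix : scaleVertex v t S = ((1 + t) / 2) • S + ((1 - t) / 2) • (D * S * D) := by
    ext i j
    by_cases hi : i = v <;> by_cases hj : j = v <;> simp [scaleVertex, hD, hi, hj] <;> ring
  rw [hmix]
  exact convex_posDef hS hflip (by linarith [ht.1]) (by linarith [ht.2]) (by ring)

theorem joinedIn_scaleVertex_zero {ι : Type*} [DecidableEq ι] {M : Set (Matrix ι ι ℝ)}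
    {S : Matrix ι ι ℝ} (v : ι)
    (h : ∀ t ∈ Set.Icc (0 : ℝ) 1, scaleVertex v t S ∈ M) : JoinedIn M S (scaleVertex v 0 S) := by
  refine (JoinedIn.ofLine (f := fun t => scaleVertex v t S) ?_ rfl (scaleVertex_one v S) ?_).symm
  · refine Continuous.continuousOn (continuous_matrix fun i j => ?_)
    simp only [scaleVertex_apply]
    split_ifs <;> fun_prop
  · rintro _ ⟨t, ht, rfl⟩
    exact h t ht

theorem isConnected_doubleMarkov_of_joinedIn_diagonal {G H : SimpleGraph V}
    (h : ∀ S ∈ doubleMarkov G H, ∃ d, JoinedIn (doubleMarkov G H) S (diagonal d)) :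
    IsConnected (doubleMarkov G H) := by
  refine IsPathConnected.isConnected ⟨1, ?_, fun {S} hS => ?_⟩
  · simpa using diagonal_mem_doubleMarkov G H (d := 1) fun _ => one_pos
  · obtain ⟨d, hd⟩ := h S hS
    refine JoinedIn.symm (hd.trans (.of_segment_subset ?_))
    rintro _ ⟨a, b, ha, hb, hab, rfl⟩
    have hd0 : ∀ i, 0 < d i := fun i => by simpa using hd.target_mem.1.diag_pos (i := i)
    convert diagonal_mem_doubleMarkov G H (d := fun i => a * d i + b) fun i => ?_
    · rw [← diagonal_one, ← diagonal_smul, ← diagonal_smul, diagonal_add]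
      simp
    · rcases ha.eq_or_lt with rfl | ha
      · simp at hab; simp [hab]
      · nlinarith [mul_pos ha (hd0 i)]

end General

section Four

theorem Matrix.PosDef.det_fin_two_pos {V : Type*} {S : Matrix V V ℝ} (hS : S.PosDef) {i j : V}
    (hij : i ≠ j) : 0 < S i i * S j j - S i j ^ 2 := by
  have h := (hS.submatrix (e := ![i, j]) (by
    intro a b; fin_cases a <;> fin_cases b <;> simp [hij, hij.symm])).det_pos
  rw [det_fin_two] at h
  simp [hS.apply_comm j i] at h
  linarith

theorem adjugate_fin_four_of_nodup (S : Matrix (Fin 4) (Fin 4) ℝ) (i j k l : Fin 4)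
    (h : [i, j, k, l].Nodup) :
    S.adjugate i j = -(S i j * (S k k * S l l - S k l * S l k)) + S i k * S k j * S l l +
      S i l * S l j * S k k - S i k * S k l * S l j - S i l * S l k * S k j := by
  rw [adjugate_fin_succ_eq_det_submatrix, det_fin_three]
  fin_cases i <;> fin_cases j <;> fin_cases k <;> fin_cases l <;>
    (try (exfalso; revert h; decide)) <;>
  · simp [Fin.succAbove, Fin.lt_def]
    ring

/-- Only one entry per unordered pair has to be checked. -/
theorem mem_doubleMarkov_iff_lt {n : ℕ} {G H : SimpleGraph (Fin n)}
    {S : Matrix (Fin n) (Fin n) ℝ} : S ∈ doubleMarkov G H ↔ S.PosDef ∧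
    ∀ i j, i < j → (¬ G.Adj i j → S.adjugate i j = 0) ∧ (¬ H.Adj i j → S i j = 0) := by
  constructor
  · rintro ⟨h, hG, hH⟩
    exact ⟨h, fun i j hij => ⟨fun hn => (h.inv_apply_eq_zero_iff i j).1 (hG i j hij.ne hn),
      hH i j hij.ne⟩⟩
  · rintro ⟨h, hGH⟩
    refine ⟨h, fun i j hij hn => ?_, fun i j hij hn => ?_⟩
    · rcases hij.lt_or_gt with hlt | hlt
      · exact (h.inv_apply_eq_zero_iff i j).2 ((hGH i j hlt).1 hn)
      · rw [h.inv.apply_comm]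
        exact (h.inv_apply_eq_zero_iff j i).2 ((hGH j i hlt).1 fun h => hn h.symm)
    · rcases hij.lt_or_gt with hlt | hlt
      · exact (hGH i j hlt).2 hn
      · rw [h.apply_comm]
        exact (hGH j i hlt).2 fun h => hn h.symm

theorem Matrix.PosDef.det_fin_three_pos {V : Type*} {S : Matrix V V ℝ} (hS : S.PosDef) {i j k : V}
    (hij : i ≠ j) (hik : i ≠ k) (hjk : j ≠ k) :
    0 < S i i * S j j * S k k + 2 * S i j * S i k * S j k - S i i * S j k ^ 2
      - S j j * S i k ^ 2 - S k k * S i j ^ 2 := by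
  have h := (hS.submatrix (e := ![i, j, k]) (by
    intro a b
    fin_cases a <;> fin_cases b <;> simp [hij, hij.symm, hik, hik.symm, hjk, hjk.symm])).det_pos
  rw [det_fin_three] at h
  simp [hS.apply_comm j i, hS.apply_comm k i, hS.apply_comm k j] at h
  linarith

theorem scaleVertex_zero_four_eq_diagonal (S : Matrix (Fin 4) (Fin 4) ℝ) {u v w : Fin 4}
    (h : [u, v, w].Nodup) :
    scaleVertex w 0 (scaleVertex v 0 (scaleVertex u 0 S)) = diagonal fun i => S i i := by
  have key : ∀ u v w i j : Fin 4, [u, v, w].Nodup → i ≠ j →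
      ((i = u ↔ j = u) → (i = v ↔ j = v) → ¬ (i = w ↔ j = w)) := by decide
  ext i j
  by_cases hij : i = j
  · subst hij
    simp [scaleVertex_apply]
  · simp only [diagonal_apply_ne _ hij, scaleVertex_apply, zero_mul, ite_eq_right_iff]
    exact fun h1 h2 h3 => absurd h1 (key u v w i j h hij h3 h2)

/-- Membership in the model when the path `0 - 1 - 2 - 3` consists of common edges. -/
theorem mem_doubleMarkov_path_iff {G H : SimpleGraph (Fin 4)}
    (hG01 : G.Adj 0 1) (hG12 : G.Adj 1 2) (hG23 : G.Adj 2 3)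
    (hH01 : H.Adj 0 1) (hH12 : H.Adj 1 2) (hH23 : H.Adj 2 3) {S : Matrix (Fin 4) (Fin 4) ℝ} :
    S ∈ doubleMarkov G H ↔ S.PosDef ∧ (¬ G.Adj 0 2 → S.adjugate 0 2 = 0) ∧
      (¬ G.Adj 0 3 → S.adjugate 0 3 = 0) ∧ (¬ G.Adj 1 3 → S.adjugate 1 3 = 0) ∧
      (¬ H.Adj 0 2 → S 0 2 = 0) ∧ (¬ H.Adj 0 3 → S 0 3 = 0) ∧ (¬ H.Adj 1 3 → S 1 3 = 0) := by
  rw [mem_doubleMarkov_iff_lt]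
  simp [Fin.forall_fin_succ, hG01, hG12, hG23, hH01, hH12, hH23]
  tauto

theorem isConnected_doubleMarkov_path_of_mul_eq_zero {G H : SimpleGraph (Fin 4)}
    (hG01 : G.Adj 0 1) (hG12 : G.Adj 1 2) (hG23 : G.Adj 2 3)
    (hH01 : H.Adj 0 1) (hH12 : H.Adj 1 2) (hH23 : H.Adj 2 3) (hH13 : ¬ H.Adj 1 3)
    (hmul : ∀ S ∈ doubleMarkov G H, ¬ G.Adj 1 3 → S 1 2 * S 2 3 = 0) :
    IsConnected (doubleMarkov G H) := by
  have hmem {S : Matrix (Fin 4) (Fin 4) ℝ} :=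
    mem_doubleMarkov_path_iff hG01 hG12 hG23 hH01 hH12 hH23 (S := S)
  refine isConnected_doubleMarkov_of_joinedIn_diagonal fun S hS => ⟨fun i => S i i, ?_⟩
  rw [← scaleVertex_zero_four_eq_diagonal S (u := 0) (v := 1) (w := 2) (by decide)]
  have hq := hmul S hS
  have e13 := (hmem.1 hS).2.2.2.2.2.2 hH13
  have hc := hS.1.apply_comm
  have c02 (S) := adjugate_fin_four_of_nodup S 0 2 1 3 (by decide)
  have c03 (S) := adjugate_fin_four_of_nodup S 0 3 1 2 (by decide)
  have c13 (S) := adjugate_fin_four_of_nodup S 1 3 0 2 (by decide)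
  have h1 : JoinedIn (doubleMarkov G H) S (scaleVertex 0 0 S) := by
    refine joinedIn_scaleVertex_zero 0 fun t ht => ?_
    obtain ⟨hpd, k02, k03, k13, s02, s03, s13⟩ := hmem.1 hS
    refine hmem.2 ⟨posDef_scaleVertex 0 ht hpd, fun h => ?_, fun h => ?_, fun h => ?_,
      fun h => ?_, fun h => ?_, fun h => ?_⟩
    · have := k02 h
      rw [c02] at this ⊢
      simp [scaleVertex_apply]
      linear_combination t * this
    · have := k03 h
      rw [c03] at this ⊢
      simp [scaleVertex_apply]
      linear_combination t * this
    · have := k13 h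
      have hq := hq h
      rw [c13] at this ⊢
      simp [scaleVertex_apply, e13] at this ⊢
      linear_combination t ^ 2 * this + (1 - t ^ 2) * S 0 0 * hq
    · simp [scaleVertex_apply, s02 h]
    · simp [scaleVertex_apply, s03 h]
    · simp [scaleVertex_apply, s13 h]
  have h2 : JoinedIn (doubleMarkov G H) (scaleVertex 0 0 S)
      (scaleVertex 1 0 (scaleVertex 0 0 S)) := by
    refine joinedIn_scaleVertex_zero 1 fun t ht => ?_
    obtain ⟨hpd, k02, k03, k13, s02, s03, s13⟩ := hmem.1 h1.target_mem
    refine hmem.2 ⟨posDef_scaleVertex 1 ht hpd, fun h => ?_, fun h => ?_, fun h => ?_,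
      fun h => ?_, fun h => ?_, fun h => ?_⟩
    · rw [c02]
      simp [scaleVertex_apply]
    · rw [c03]
      simp [scaleVertex_apply]
    · have := k13 h
      rw [c13] at this ⊢
      simp [scaleVertex_apply, e13] at this ⊢
      tauto
    all_goals simp [scaleVertex_apply, e13]
  refine (h1.trans h2).trans (joinedIn_scaleVertex_zero 2 fun t ht => ?_)
  refine hmem.2 ⟨posDef_scaleVertex 2 ht h2.target_mem.1, fun h => ?_, fun h => ?_, fun h => ?_,
    fun h => ?_, fun h => ?_, fun h => ?_⟩
  · rw [c02]; simp [scaleVertex_apply]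
  · rw [c03]; simp [scaleVertex_apply]
  · rw [c13]; simp [scaleVertex_apply]
  all_goals simp [scaleVertex_apply]

/-- The case of a path of common edges in which the first vertex carries the extra edge. -/
theorem isConnected_doubleMarkov_path_of_left {G H : SimpleGraph (Fin 4)}
    (hG01 : G.Adj 0 1) (hG12 : G.Adj 1 2) (hG23 : G.Adj 2 3)
    (hH01 : H.Adj 0 1) (hH12 : H.Adj 1 2) (hH23 : H.Adj 2 3) (hH13 : ¬ H.Adj 1 3)
    (h : (¬ H.Adj 0 3 ∧ (¬ G.Adj 0 2 ∨ ¬ H.Adj 0 2)) ∨ (¬ H.Adj 0 2 ∧ ¬ G.Adj 0 3)) :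
    IsConnected (doubleMarkov G H) := by
  refine isConnected_doubleMarkov_path_of_mul_eq_zero hG01 hG12 hG23 hH01 hH12 hH23 hH13
    fun S hS hG13 => ?_
  obtain ⟨hpd, k02, k03, k13, s02, s03, s13⟩ :=
    (mem_doubleMarkov_path_iff hG01 hG12 hG23 hH01 hH12 hH23).1 hS
  have c10 := hpd.apply_comm 1 0
  have c21 := hpd.apply_comm 2 1
  have c20 := hpd.apply_comm 2 0
  have hd (i) : S i i ≠ 0 := hpd.diag_pos.ne'
  have h13 := s13 hH13
  have h31 : S 3 1 = 0 := by rw [hpd.apply_comm, h13]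
  replace k13 := k13 hG13
  rw [adjugate_fin_four_of_nodup S 1 3 0 2 (by decide)] at k13
  rcases h with ⟨hH03, hG02 | hH02⟩ | ⟨hH02, hG03⟩
  · replace k02 := k02 hG02
    rw [adjugate_fin_four_of_nodup S 0 2 1 3 (by decide)] at k02
    have h03 := s03 hH03
    simp only [h13, h31, h03, c10, c20] at k02 k13
    have h02 : S 0 2 * S 1 1 = S 0 1 * S 1 2 :=
      mul_right_cancel₀ (hd 3) (by linear_combination -k02)
    refine (mul_eq_zero_iff_right (hpd.det_fin_two_pos (i := 0) (j := 1) (by decide)).ne').1 ?_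
    linear_combination S 1 1 * k13 + S 0 1 * S 2 3 * h02
  · have h02 := s02 hH02
    have h03 := s03 hH03
    simp only [h13, h02, h03, c10, c20] at k13
    exact (mul_eq_zero_iff_right (hd 0)).1 (by linear_combination k13)
  · replace k03 := k03 hG03
    rw [adjugate_fin_four_of_nodup S 0 3 1 2 (by decide)] at k03
    have h02 := s02 hH02
    have hdet := hpd.det_fin_three_pos (i := 0) (j := 1) (k := 2) (by decide) (by decide)
      (by decide)
    simp only [h13, h02, c10, c21, c20] at k03 k13 hdet
    refine (mul_eq_zero_iff_right hdet.ne').1 ?_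
    linear_combination (S 1 1 * S 2 2 - S 1 2 ^ 2) * k13 + S 0 1 * S 2 2 * k03

/-- Membership in the model when the star with centre `0` consists of common edges. -/
theorem mem_doubleMarkov_star_iff {G H : SimpleGraph (Fin 4)}
    (hG : ∀ i ≠ 0, G.Adj 0 i) (hH : ∀ i ≠ 0, H.Adj 0 i) {S : Matrix (Fin 4) (Fin 4) ℝ} :
    S ∈ doubleMarkov G H ↔ S.PosDef ∧ (¬ G.Adj 1 2 → S.adjugate 1 2 = 0) ∧
      (¬ G.Adj 1 3 → S.adjugate 1 3 = 0) ∧ (¬ G.Adj 2 3 → S.adjugate 2 3 = 0) ∧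
      (¬ H.Adj 1 2 → S 1 2 = 0) ∧ (¬ H.Adj 1 3 → S 1 3 = 0) ∧ (¬ H.Adj 2 3 → S 2 3 = 0) := by
  have := hG 1 (by decide)
  have := hG 2 (by decide)
  have := hG 3 (by decide)
  have := hH 1 (by decide)
  have := hH 2 (by decide)
  have := hH 3 (by decide)
  rw [mem_doubleMarkov_iff_lt]
  simp [Fin.forall_fin_succ, *]
  tauto

theorem isConnected_doubleMarkov_star_of_one_extra {G H : SimpleGraph (Fin 4)}
    (hG : ∀ i ≠ 0, G.Adj 0 i) (hH : ∀ i ≠ 0, H.Adj 0 i) (hH13 : ¬ H.Adj 1 3) (hH23 : ¬ H.Adj 2 3)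
    (h12 : ¬ (G.Adj 1 2 ∧ H.Adj 1 2)) : IsConnected (doubleMarkov G H) := by
  have hmem {S : Matrix (Fin 4) (Fin 4) ℝ} := mem_doubleMarkov_star_iff hG hH (S := S)
  refine isConnected_doubleMarkov_of_joinedIn_diagonal fun S hS => ⟨fun i => S i i, ?_⟩
  rw [← scaleVertex_zero_four_eq_diagonal S (u := 1) (v := 2) (w := 3) (by decide)]
  have c12 (S) := adjugate_fin_four_of_nodup S 1 2 0 3 (by decide)
  have c13 (S) := adjugate_fin_four_of_nodup S 1 3 0 2 (by decide)
  have c23 (S) := adjugate_fin_four_of_nodup S 2 3 0 1 (by decide)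
  have e13 := (hmem.1 hS).2.2.2.2.2.1 hH13
  have e23 := (hmem.1 hS).2.2.2.2.2.2 hH23
  have hq : ¬ G.Adj 2 3 → S 0 2 * S 0 3 = 0 := fun hG23 => by
    obtain ⟨hpd, k12, k13, k23, s12, s13, s23⟩ := hmem.1 hS
    have c10 := hpd.apply_comm 1 0
    have c21 := hpd.apply_comm 2 1
    have c20 := hpd.apply_comm 2 0
    have c30 := hpd.apply_comm 3 0
    have e32 : S 3 2 = 0 := by rw [hpd.apply_comm, e23]
    replace k23 := k23 hG23
    rw [c23] at k23
    by_cases hG12 : G.Adj 1 2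
    · have e12 := s12 fun h => h12 ⟨hG12, h⟩
      simp only [e13, e23, e12, c10, c20, c21] at k23
      exact (mul_eq_zero_iff_right (hpd.diag_pos (i := 1)).ne').1 (by linear_combination k23)
    · replace k12 := k12 hG12
      rw [c12] at k12
      have hdet := hpd.det_fin_three_pos (i := 0) (j := 1) (k := 3) (by decide) (by decide)
        (by decide)
      simp only [e13, e23, e32, c10, c20, c21, c30] at k12 k23 hdet
      refine (mul_eq_zero_iff_right hdet.ne').1 ?_
      linear_combination (S 0 0 * S 3 3 - S 0 3 ^ 2) * k23 - S 0 1 * S 0 3 * k12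
  have h1 : JoinedIn (doubleMarkov G H) S (scaleVertex 1 0 S) := by
    refine joinedIn_scaleVertex_zero 1 fun t ht => ?_
    obtain ⟨hpd, k12, k13, k23, s12, s13, s23⟩ := hmem.1 hS
    refine hmem.2 ⟨posDef_scaleVertex 1 ht hpd, fun h => ?_, fun h => ?_, fun h => ?_,
      fun h => ?_, fun h => ?_, fun h => ?_⟩
    · have := k12 h
      rw [c12] at this ⊢
      simp [scaleVertex_apply]
      linear_combination t * this
    · have := k13 h
      rw [c13] at this ⊢
      simp [scaleVertex_apply]
      linear_combination t * this
    · have := k23 h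
      have hq := hq h
      rw [c23] at this ⊢
      simp [scaleVertex_apply, e13, e23, hpd.apply_comm 2 0] at this ⊢
      linear_combination t ^ 2 * this + (1 - t ^ 2) * S 1 1 * hq
    · simp [scaleVertex_apply, s12 h]
    · simp [scaleVertex_apply, e13]
    · simp [scaleVertex_apply, e23]
  have h2 : JoinedIn (doubleMarkov G H) (scaleVertex 1 0 S)
      (scaleVertex 2 0 (scaleVertex 1 0 S)) := by
    refine joinedIn_scaleVertex_zero 2 fun t ht => ?_
    obtain ⟨hpd, k12, k13, k23, s12, s13, s23⟩ := hmem.1 h1.target_mem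
    refine hmem.2 ⟨posDef_scaleVertex 2 ht hpd, fun h => ?_, fun h => ?_, fun h => ?_,
      fun h => ?_, fun h => ?_, fun h => ?_⟩
    · rw [c12]; simp [scaleVertex_apply]
    · rw [c13]; simp [scaleVertex_apply]
    · have := k23 h
      rw [c23] at this ⊢
      simp [scaleVertex_apply, e23] at this ⊢
      tauto
    all_goals simp [scaleVertex_apply, e23]
  refine (h1.trans h2).trans (joinedIn_scaleVertex_zero 3 fun t ht => ?_)
  refine hmem.2 ⟨posDef_scaleVertex 3 ht h2.target_mem.1, fun h => ?_, fun h => ?_, fun h => ?_,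
    fun h => ?_, fun h => ?_, fun h => ?_⟩
  · rw [c12]; simp [scaleVertex_apply]
  · rw [c13]; simp [scaleVertex_apply]
  · rw [c23]; simp [scaleVertex_apply]
  all_goals simp [scaleVertex_apply]

/-- If all pairs outside the star are non-edges of `H` with at most one exception. -/
theorem isConnected_doubleMarkov_star_of_two_missing {G H : SimpleGraph (Fin 4)}
    (hG : ∀ i ≠ 0, G.Adj 0 i) (hH : ∀ i ≠ 0, H.Adj 0 i)
    (h12 : ¬ (G.Adj 1 2 ∧ H.Adj 1 2)) (h13 : ¬ (G.Adj 1 3 ∧ H.Adj 1 3))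
    (h23 : ¬ (G.Adj 2 3 ∧ H.Adj 2 3))
    (h : (¬ H.Adj 1 3 ∧ ¬ H.Adj 2 3) ∨ (¬ H.Adj 1 2 ∧ ¬ H.Adj 2 3) ∨
      (¬ H.Adj 1 2 ∧ ¬ H.Adj 1 3)) : IsConnected (doubleMarkov G H) := by
  have aux (F : SimpleGraph (Fin 4)) (hF : ∀ i ≠ 0, F.Adj 0 i) (e : Equiv.Perm (Fin 4))
      (he : e 0 = 0) : ∀ i ≠ 0, (F.comap e).Adj 0 i := fun i hi => by
    simpa [he] using hF (e i) fun h => hi (e.injective (h.trans he.symm))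
  rcases h with ⟨h, h'⟩ | ⟨h, h'⟩ | ⟨h, h'⟩
  · exact isConnected_doubleMarkov_star_of_one_extra hG hH h h' h12
  · refine isConnected_doubleMarkov_of_comap (Equiv.swap 2 3)
      (isConnected_doubleMarkov_star_of_one_extra (aux G hG _ (by decide)) (aux H hH _ (by decide))
        h ?_ h13)
    exact fun h => h' h.symm
  · refine isConnected_doubleMarkov_of_comap (Equiv.swap 1 3)
      (isConnected_doubleMarkov_star_of_one_extra (aux G hG _ (by decide)) (aux H hH _ (by decide))
        (fun h => h' h.symm) (fun h' => h h'.symm) fun h => h23 ⟨h.1.symm, h.2.symm⟩)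

theorem isConnected_doubleMarkov_star {G H : SimpleGraph (Fin 4)}
    (hG : ∀ i ≠ 0, G.Adj 0 i) (hH : ∀ i ≠ 0, H.Adj 0 i)
    (h12 : ¬ (G.Adj 1 2 ∧ H.Adj 1 2)) (h13 : ¬ (G.Adj 1 3 ∧ H.Adj 1 3))
    (h23 : ¬ (G.Adj 2 3 ∧ H.Adj 2 3)) : IsConnected (doubleMarkov G H) := by
  have complete (F : SimpleGraph (Fin 4)) (hF : ∀ i ≠ 0, F.Adj 0 i) (h12 : F.Adj 1 2)
      (h13 : F.Adj 1 3) (h23 : F.Adj 2 3) : ∀ i j, i ≠ j → F.Adj i j := by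
    have := hF 1 (by decide)
    have := hF 2 (by decide)
    have := hF 3 (by decide)
    simp [Fin.forall_fin_succ, F.adj_comm 1 0, F.adj_comm 2 0, F.adj_comm 3 0, F.adj_comm 2 1,
      F.adj_comm 3 1, F.adj_comm 3 2, *]
  have hcomp := complete G hG
  have hcomp' := complete H hH
  by_cases hGc : G.Adj 1 2 ∧ G.Adj 1 3 ∧ G.Adj 2 3
  · exact isConnected_doubleMarkov_of_complete_left (hcomp hGc.1 hGc.2.1 hGc.2.2)
  by_cases hHc : H.Adj 1 2 ∧ H.Adj 1 3 ∧ H.Adj 2 3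
  · exact isConnected_doubleMarkov_of_complete_right (hcomp' hHc.1 hHc.2.1 hHc.2.2)
  by_cases hH2 : (¬ H.Adj 1 3 ∧ ¬ H.Adj 2 3) ∨ (¬ H.Adj 1 2 ∧ ¬ H.Adj 2 3) ∨
      (¬ H.Adj 1 2 ∧ ¬ H.Adj 1 3)
  · exact isConnected_doubleMarkov_star_of_two_missing hG hH h12 h13 h23 hH2
  · rw [and_comm] at h12 h13 h23
    exact isConnected_doubleMarkov_swap
      (isConnected_doubleMarkov_star_of_two_missing hH hG h12 h13 h23 (by grind only))

theorem isConnected_doubleMarkov_path_of_two_missing {G H : SimpleGraph (Fin 4)}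
    (hG01 : G.Adj 0 1) (hG12 : G.Adj 1 2) (hG23 : G.Adj 2 3)
    (hH01 : H.Adj 0 1) (hH12 : H.Adj 1 2) (hH23 : H.Adj 2 3)
    (h02 : ¬ (G.Adj 0 2 ∧ H.Adj 0 2)) (h03 : ¬ (G.Adj 0 3 ∧ H.Adj 0 3))
    (h13 : ¬ (G.Adj 1 3 ∧ H.Adj 1 3))
    (h : (¬ H.Adj 0 3 ∧ ¬ H.Adj 1 3) ∨ (¬ H.Adj 0 2 ∧ ¬ H.Adj 1 3) ∨
      (¬ H.Adj 0 2 ∧ ¬ H.Adj 0 3)) : IsConnected (doubleMarkov G H) := by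
  by_cases hH13 : H.Adj 1 3
  · refine isConnected_doubleMarkov_of_comap Fin.revPerm
      (isConnected_doubleMarkov_path_of_left hG23.symm hG12.symm hG01.symm hH23.symm hH12.symm
        hH01.symm (fun h => ?_) (.inl ⟨fun h => ?_, .inl fun h => ?_⟩))
    · have : H.Adj 0 2 := h.symm
      tauto
    · have : H.Adj 0 3 := h.symm
      tauto
    · have : G.Adj 1 3 := h.symm
      tauto
  · exact isConnected_doubleMarkov_path_of_left hG01 hG12 hG23 hH01 hH12 hH23 hH13 (by tauto)

theorem isConnected_doubleMarkov_path {G H : SimpleGraph (Fin 4)}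
    (hG01 : G.Adj 0 1) (hG12 : G.Adj 1 2) (hG23 : G.Adj 2 3)
    (hH01 : H.Adj 0 1) (hH12 : H.Adj 1 2) (hH23 : H.Adj 2 3)
    (h02 : ¬ (G.Adj 0 2 ∧ H.Adj 0 2)) (h03 : ¬ (G.Adj 0 3 ∧ H.Adj 0 3))
    (h13 : ¬ (G.Adj 1 3 ∧ H.Adj 1 3)) : IsConnected (doubleMarkov G H) := by
  have complete (F : SimpleGraph (Fin 4)) (h01 : F.Adj 0 1) (h12 : F.Adj 1 2) (h23 : F.Adj 2 3)
      (h02 : F.Adj 0 2) (h03 : F.Adj 0 3) (h13 : F.Adj 1 3) : ∀ i j, i ≠ j → F.Adj i j := by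
    simp [Fin.forall_fin_succ, F.adj_comm 1 0, F.adj_comm 2 0, F.adj_comm 3 0, F.adj_comm 2 1,
      F.adj_comm 3 1, F.adj_comm 3 2, *]
  by_cases hGc : G.Adj 0 2 ∧ G.Adj 0 3 ∧ G.Adj 1 3
  · exact isConnected_doubleMarkov_of_complete_left
      (complete G hG01 hG12 hG23 hGc.1 hGc.2.1 hGc.2.2)
  by_cases hHc : H.Adj 0 2 ∧ H.Adj 0 3 ∧ H.Adj 1 3
  · exact isConnected_doubleMarkov_of_complete_right
      (complete H hH01 hH12 hH23 hHc.1 hHc.2.1 hHc.2.2)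
  by_cases hH2 : (¬ H.Adj 0 3 ∧ ¬ H.Adj 1 3) ∨ (¬ H.Adj 0 2 ∧ ¬ H.Adj 1 3) ∨
      (¬ H.Adj 0 2 ∧ ¬ H.Adj 0 3)
  · exact isConnected_doubleMarkov_path_of_two_missing hG01 hG12 hG23 hH01 hH12 hH23 h02 h03 h13 hH2
  · rw [and_comm] at h02 h03 h13
    exact isConnected_doubleMarkov_swap (isConnected_doubleMarkov_path_of_two_missing
      hH01 hH12 hH23 hG01 hG12 hG23 h02 h03 h13 (by grind only))

end Four

section Three

theorem isConnected_doubleMarkov_three_path {G H : SimpleGraph (Fin 3)}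
    (hG01 : G.Adj 0 1) (hG12 : G.Adj 1 2) (hH01 : H.Adj 0 1) (hH12 : H.Adj 1 2) :
    IsConnected (doubleMarkov G H) := by
  have complete (F : SimpleGraph (Fin 3)) (h01 : F.Adj 0 1) (h12 : F.Adj 1 2)
      (h02 : F.Adj 0 2) : ∀ i j, i ≠ j → F.Adj i j := by
    simp [Fin.forall_fin_succ, F.adj_comm 1 0, F.adj_comm 2 0, F.adj_comm 2 1, *]
  by_cases hG02 : G.Adj 0 2
  · exact isConnected_doubleMarkov_of_complete_left (complete G hG01 hG12 hG02)
  by_cases hH02 : H.Adj 0 2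
  · exact isConnected_doubleMarkov_of_complete_right (complete H hH01 hH12 hH02)
  have hmem {S : Matrix (Fin 3) (Fin 3) ℝ} : S ∈ doubleMarkov G H ↔
      S.PosDef ∧ S 0 1 * S 1 2 = 0 ∧ S 0 2 = 0 := by
    rw [mem_doubleMarkov_iff_lt]
    simp [Fin.forall_fin_succ, hG01, hG12, hH01, hH12, hG02, hH02, adjugate_fin_three]
    intro _ h
    simp [h]
  refine isConnected_doubleMarkov_of_joinedIn_diagonal fun S hS => ⟨fun i => S i i, ?_⟩
  obtain ⟨hpd, hmul, h02⟩ := hmem.1 hS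
  have h20 := (hpd.apply_comm 2 0).trans h02
  have h1 : JoinedIn (doubleMarkov G H) S (scaleVertex 0 0 S) := by
    refine joinedIn_scaleVertex_zero 0 fun t ht => hmem.2 ⟨posDef_scaleVertex 0 ht hpd, ?_, ?_⟩
    · simpa [scaleVertex_apply, or_assoc] using .inr (mul_eq_zero.1 hmul)
    · simp [scaleVertex_apply, h02]
  have h2 : JoinedIn (doubleMarkov G H) (scaleVertex 0 0 S)
      (scaleVertex 1 0 (scaleVertex 0 0 S)) := by
    refine joinedIn_scaleVertex_zero 1 fun t ht =>
      hmem.2 ⟨posDef_scaleVertex 1 ht h1.target_mem.1, ?_, ?_⟩ <;> simp [scaleVertex_apply]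
  convert h1.trans h2
  ext i j
  fin_cases i <;> fin_cases j <;> simp [scaleVertex_apply]

end Three

section Classification

/-- The symmetric Boolean adjacency table of a graph on four vertices. -/
def adjTable (a b c d e g : Bool) : Fin 4 → Fin 4 → Bool :=
  ![![false, a, b, c], ![a, false, d, e], ![b, d, false, g], ![c, e, g, false]]

/-- The vertices `0, 1, 2, 3` form a path in this order, with no other edges. -/
def IsPathTable (F : Fin 4 → Fin 4 → Bool) : Prop :=
  F 0 1 ∧ F 1 2 ∧ F 2 3 ∧ ¬ F 0 2 ∧ ¬ F 0 3 ∧ ¬ F 1 3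

/-- The vertices `1, 2, 3` are joined to `0`, and there are no other edges. -/
def IsStarTable (F : Fin 4 → Fin 4 → Bool) : Prop :=
  F 0 1 ∧ F 0 2 ∧ F 0 3 ∧ ¬ F 1 2 ∧ ¬ F 1 3 ∧ ¬ F 2 3

instance : DecidablePred IsPathTable := fun _ => by unfold IsPathTable; infer_instance

instance : DecidablePred IsStarTable := fun _ => by unfold IsStarTable; infer_instance

/-- A connected graph on four vertices with at most three edges is a path or a star. -/
theorem exists_perm_path_or_star : ∀ a b c d e g : Bool,
    ((a || b || c) && (a || d || e) && (b || d || g) && (c || e || g) &&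
      (b || c || d || e) && (a || c || d || g) && (a || b || e || g)) →
    a.toNat + b.toNat + c.toNat + d.toNat + e.toNat + g.toNat ≤ 3 →
    ∃ σ : Equiv.Perm (Fin 4),
      IsPathTable (fun i j => adjTable a b c d e g (σ i) (σ j)) ∨
      IsStarTable (fun i j => adjTable a b c d e g (σ i) (σ j)) := by
  decide +kernel

theorem adjTable_adj (F : SimpleGraph (Fin 4)) [DecidableRel F.Adj] (i j : Fin 4) :
    adjTable (F.Adj 0 1) (F.Adj 0 2) (F.Adj 0 3) (F.Adj 1 2) (F.Adj 1 3) (F.Adj 2 3) i j =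
      decide (F.Adj i j) := by
  fin_cases i <;> fin_cases j <;> simp [adjTable, F.adj_comm 1 0, F.adj_comm 2 0, F.adj_comm 3 0,
    F.adj_comm 2 1, F.adj_comm 3 1, F.adj_comm 3 2]

theorem sum_adj_le_three (F : SimpleGraph (Fin 4)) [DecidableRel F.Adj]
    (h : Nat.card F.edgeSet ≤ 3) :
    (decide (F.Adj 0 1)).toNat + (decide (F.Adj 0 2)).toNat + (decide (F.Adj 0 3)).toNat +
      (decide (F.Adj 1 2)).toNat + (decide (F.Adj 1 3)).toNat + (decide (F.Adj 2 3)).toNat ≤ 3 := by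
  rw [Nat.card_eq_fintype_card, ← SimpleGraph.edgeFinset_card] at h
  have hsum := F.sum_degrees_eq_twice_card_edges
  have hdeg (v) : F.degree v = ∑ w, (decide (F.Adj v w)).toNat := by
    rw [← SimpleGraph.card_neighborFinset_eq_degree, SimpleGraph.neighborFinset_eq_filter,
      Finset.card_filter]
    exact Finset.sum_congr rfl fun w _ => by by_cases h : F.Adj v w <;> simp [h]
  simp only [hdeg, Fin.sum_univ_four, F.adj_comm 1 0, F.adj_comm 2 0, F.adj_comm 3 0,
    F.adj_comm 2 1, F.adj_comm 3 1, F.adj_comm 3 2, SimpleGraph.irrefl, decide_false,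
    Bool.toNat_false] at hsum
  omega

theorem isConnected_doubleMarkov_four {G H : SimpleGraph (Fin 4)}
    (hcut : ∀ A : Set (Fin 4), A.Nonempty → Aᶜ.Nonempty → ∃ i ∈ A, ∃ j ∉ A, (G ⊓ H).Adj i j)
    (hcard : Nat.card (G ⊓ H).edgeSet ≤ 3) : IsConnected (doubleMarkov G H) := by
  classical
  obtain ⟨F, hF⟩ : ∃ F, F = G ⊓ H := ⟨_, rfl⟩
  rw [← hF] at hcard
  simp only [← hF] at hcut
  have hcut' (A : Finset (Fin 4)) (h : A.Nonempty) (h' : Aᶜ.Nonempty) :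
      ∃ i ∈ A, ∃ j ∉ A, F.Adj i j := hcut A h (by
    rwa [← Finset.coe_compl, Finset.coe_nonempty])
  have c1 := hcut' {0} (by decide) (by decide)
  have c2 := hcut' {1} (by decide) (by decide)
  have c3 := hcut' {2} (by decide) (by decide)
  have c4 := hcut' {3} (by decide) (by decide)
  have c5 := hcut' {0, 1} (by decide) (by decide)
  have c6 := hcut' {0, 2} (by decide) (by decide)
  have c7 := hcut' {0, 3} (by decide) (by decide)
  simp [Fin.exists_fin_succ, F.adj_comm 1 0, F.adj_comm 2 0, F.adj_comm 3 0, F.adj_comm 2 1,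
    F.adj_comm 3 1, F.adj_comm 3 2] at c1 c2 c3 c4 c5 c6 c7
  obtain ⟨σ, hσ⟩ := exists_perm_path_or_star (F.Adj 0 1) (F.Adj 0 2) (F.Adj 0 3) (F.Adj 1 2)
    (F.Adj 1 3) (F.Adj 2 3) (by
      simp only [Bool.and_eq_true, Bool.or_eq_true, decide_eq_true_eq, or_assoc, and_assoc] at *
      exact ⟨c1, c2, c3, c4, c5, c6, c7⟩)
    (sum_adj_le_three F hcard)
  simp only [adjTable_adj, IsPathTable, IsStarTable, decide_eq_true_eq] at hσ
  simp only [hF, SimpleGraph.inf_adj] at hσ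
  refine isConnected_doubleMarkov_of_comap σ ?_
  rcases hσ with ⟨h01, h12, h23, h02, h03, h13⟩ | ⟨h01, h02, h03, h12, h13, h23⟩
  · exact isConnected_doubleMarkov_path h01.1 h12.1 h23.1 h01.2 h12.2 h23.2 h02 h03 h13
  · refine isConnected_doubleMarkov_star ?_ ?_ h12 h13 h23
    · simp [Fin.forall_fin_succ, h01.1, h02.1, h03.1]
    · simp [Fin.forall_fin_succ, h01.2, h02.2, h03.2]

theorem isConnected_doubleMarkov_three {G H : SimpleGraph (Fin 3)}
    (hcut : ∀ A : Set (Fin 3), A.Nonempty → Aᶜ.Nonempty → ∃ i ∈ A, ∃ j ∉ A, (G ⊓ H).Adj i j) :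
    IsConnected (doubleMarkov G H) := by
  have hcut' (A : Finset (Fin 3)) (h : A.Nonempty) (h' : Aᶜ.Nonempty) :
      ∃ i ∈ A, ∃ j ∉ A, (G ⊓ H).Adj i j := hcut A h (by
    rwa [← Finset.coe_compl, Finset.coe_nonempty])
  have c1 := hcut' {0} (by decide) (by decide)
  have c2 := hcut' {1} (by decide) (by decide)
  have c3 := hcut' {2} (by decide) (by decide)
  simp [Fin.exists_fin_succ, (G ⊓ H).adj_comm 1 0, (G ⊓ H).adj_comm 2 0,
    (G ⊓ H).adj_comm 2 1, -SimpleGraph.inf_adj] at c1 c2 c3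
  by_cases h01 : (G ⊓ H).Adj 0 1
  · by_cases h12 : (G ⊓ H).Adj 1 2
    · exact isConnected_doubleMarkov_three_path h01.1 h12.1 h01.2 h12.2
    · have h02 : (G ⊓ H).Adj 0 2 := by tauto
      exact isConnected_doubleMarkov_of_comap (Equiv.swap 0 1)
        (isConnected_doubleMarkov_three_path h01.1.symm h02.1 h01.2.symm h02.2)
  · have h02 : (G ⊓ H).Adj 0 2 := by tauto
    have h12 : (G ⊓ H).Adj 1 2 := by tauto
    exact isConnected_doubleMarkov_of_comap (Equiv.swap 1 2)
      (isConnected_doubleMarkov_three_path h02.1 h12.1.symm h02.2 h12.2.symm)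

end Classification

section Induction

theorem connected_of_forall_cut {V : Type*} [Nonempty V] {F : SimpleGraph V}
    (hcut : ∀ A : Set V, A.Nonempty → Aᶜ.Nonempty → ∃ i ∈ A, ∃ j ∉ A, F.Adj i j) :
    F.Connected := by
  refine ⟨fun v w => by_contra fun hvw => ?_⟩
  obtain ⟨i, hi, j, hj, hij⟩ := hcut {x | F.Reachable v x} ⟨v, .refl v⟩ ⟨w, hvw⟩
  exact hj (SimpleGraph.Reachable.trans hi hij.reachable)

theorem card_edgeSet_comap_le {V W : Type*} [Finite V] (F : SimpleGraph V) (f : W ↪ V) :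
    Nat.card (F.comap f).edgeSet ≤ Nat.card F.edgeSet :=
  Nat.card_le_card_of_injective _ (SimpleGraph.Embedding.comap f F).mapEdgeSet.injective

theorem isConnected_doubleMarkov_of_forall_cut {V : Type*} [Fintype V] [DecidableEq V]
    {G H : SimpleGraph V}
    (hcut : ∀ A : Set V, A.Nonempty → Aᶜ.Nonempty → ∃ i ∈ A, ∃ j ∉ A, (G ⊓ H).Adj i j)
    (hcard : Nat.card (G ⊓ H).edgeSet ≤ 3) : IsConnected (doubleMarkov G H) := by
  rcases isEmpty_or_nonempty V with hV | hV
  · exact isConnected_doubleMarkov_of_complete_left fun i => hV.elim i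
  have hle := (connected_of_forall_cut hcut).card_vert_le_card_edgeSet_add_one
  obtain ⟨k, ⟨e⟩⟩ := Finite.exists_equiv_fin V
  have hk : k ≤ 4 := by
    have := Nat.card_congr e
    simp only [Nat.card_fin] at this
    omega
  refine isConnected_doubleMarkov_of_comap e.symm ?_
  have hcut' (A : Set (Fin k)) (h : A.Nonempty) (h' : Aᶜ.Nonempty) :
      ∃ i ∈ A, ∃ j ∉ A, (G.comap e.symm ⊓ H.comap e.symm).Adj i j := by
    obtain ⟨i, hi, j, hj, hij⟩ := hcut (e ⁻¹' A) (h.preimage e.surjective)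
      (h'.preimage e.surjective)
    exact ⟨e i, hi, e j, hj, by simpa using hij⟩
  have hcard' : Nat.card (G.comap e.symm ⊓ H.comap e.symm).edgeSet ≤ 3 :=
    (card_edgeSet_comap_le (G ⊓ H) e.symm.toEmbedding).trans hcard
  clear hcut hcard hle
  interval_cases k
  · exact isConnected_doubleMarkov_of_complete_left fun i => i.elim0
  · exact isConnected_doubleMarkov_of_complete_left fun i j h => absurd (Subsingleton.elim i j) h
  · have h01 : (G.comap e.symm).Adj 0 1 := by
      obtain ⟨i, hi, j, hj, hij⟩ := hcut' {0} ⟨0, rfl⟩ ⟨1, by simp⟩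
      obtain rfl : i = 0 := hi
      obtain rfl : j = 1 := by
        rw [Set.mem_singleton_iff] at hj
        omega
      exact hij.1
    refine isConnected_doubleMarkov_of_complete_left fun i j h => ?_
    fin_cases i <;> fin_cases j
    exacts [absurd rfl h, h01, h01.symm, absurd rfl h]
  · exact isConnected_doubleMarkov_three hcut'
  · exact isConnected_doubleMarkov_four hcut' hcard'

theorem isConnected_doubleMarkov_of_card_le_three {V : Type*} [Fintype V] [DecidableEq V]
    (G H : SimpleGraph V) (hcard : Nat.card (G ⊓ H).edgeSet ≤ 3) :
    IsConnected (doubleMarkov G H) := by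
  classical
  induction hn : Fintype.card V using Nat.strong_induction_on generalizing V with
  | _ n ih =>
  by_cases hcut : ∀ A : Set V, A.Nonempty → Aᶜ.Nonempty → ∃ i ∈ A, ∃ j ∉ A, (G ⊓ H).Adj i j
  · exact isConnected_doubleMarkov_of_forall_cut hcut hcard
  · push Not at hcut
    obtain ⟨A, ⟨a, ha⟩, ⟨b, hb⟩, hAB⟩ := hcut
    refine isConnected_doubleMarkov_of_comap (Equiv.Set.sumCompl A)
      (isConnected_doubleMarkov_sum (fun v w => hAB v v.2 w w.2) ?_ ?_)
    · exact ih _ (hn ▸ Fintype.card_subtype_lt (x := b) hb) _ _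
        ((card_edgeSet_comap_le (G ⊓ H) (Function.Embedding.subtype _)).trans hcard) rfl
    · exact ih _ (hn ▸ Fintype.card_subtype_lt (x := a) (not_not.2 ha)) _ _
        ((card_edgeSet_comap_le (G ⊓ H) (Function.Embedding.subtype _)).trans hcard) rfl

end Induction

/-- If `G` and `H` have at most three common edges, then the Gaussian double
Markovian model `M(G,H)` is connected in the Euclidean topology. -/
theorem doubleMarkov_connected_of_card_common_edges_le_three {n : ℕ}
    (G H : SimpleGraph (Fin n))
    (hcard : (G.edgeSet ∩ H.edgeSet).ncard ≤ 3) :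
    IsConnected {S : Matrix (Fin n) (Fin n) ℝ | S.PosDef ∧
      (∀ i j : Fin n, i ≠ j → ¬ G.Adj i j → S⁻¹ i j = 0) ∧
      (∀ i j : Fin n, i ≠ j → ¬ H.Adj i j → S i j = 0)} := by
  refine isConnected_doubleMarkov_of_card_le_three G H ?_
  rwa [SimpleGraph.edgeSet_inf, Nat.card_coe_set_eq]
end

section
/- Let n = 4, N = {1,2,3,4}, and let G be the graph with edge set E_G = {{1,2},{1,4},{2,3},{2,4},{3,4}} (the complete graph K₄ minus the edge {1,3}) and H the graph with edge set E_H = {{1,2},{1,3},{2,3},{3,4}}. Then M₁(G,H) equals the set of matrices of the form [[1, a, a·b, 0],[a, 1, b, 0],[a·b, b, 1, c],[0, 0, c, 1]] with a ∈ (−1,1) and b² + c² < 1. -/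
/-- The form of the matrix `!![1, a, d, 0; a, 1, b, 0; d, b, 1, c; 0, 0, c, 1]` at `x`. -/
theorem quadraticForm_eq (a b c d : ℝ) (x : Fin 4 → ℝ) :
    x ⬝ᵥ Matrix.mulVec !![1, a, d, 0; a, 1, b, 0; d, b, 1, c; 0, 0, c, 1] x =
      (x 3 + c * x 2) ^ 2 + (x 1 + a * x 0 + b * x 2) ^ 2 + (1 - a ^ 2) * x 0 ^ 2 +
        (1 - b ^ 2 - c ^ 2) * x 2 ^ 2 + 2 * (d - a * b) * x 0 * x 2 := by
  simp [dotProduct, Matrix.mulVec, Fin.sum_univ_four]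
  ring

theorem posDef_of_lt {a b c : ℝ} (ha : a ^ 2 < 1) (hbc : b ^ 2 + c ^ 2 < 1) :
    (!![1, a, a * b, 0; a, 1, b, 0; a * b, b, 1, c; 0, 0, c, 1] :
      Matrix (Fin 4) (Fin 4) ℝ).PosDef := by
  refine Matrix.PosDef.of_dotProduct_mulVec_pos ?_ fun x hx => ?_
  · ext i j
    fin_cases i <;> fin_cases j <;> simp
  rw [star_trivial, quadraticForm_eq, sub_self, mul_zero, zero_mul, zero_mul, add_zero]
  have h0 : 0 < 1 - a ^ 2 := by linarith
  have h2 : 0 < 1 - b ^ 2 - c ^ 2 := by linarith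
  by_cases hx0 : x 0 = 0
  · by_cases hx2 : x 2 = 0
    · have hx13 : x 1 ≠ 0 ∨ x 3 ≠ 0 := by
        by_contra! h
        exact hx (funext fun i => by fin_cases i <;> simp [hx0, hx2, h])
      rw [hx0, hx2]
      rcases hx13 with h | h <;> have := sq_pos_of_ne_zero h <;>
        nlinarith [sq_nonneg (x 1), sq_nonneg (x 3)]
    · positivity
  · positivity

theorem sq_lt_one_of_posDef {a b c d : ℝ}
    (h : (!![1, a, d, 0; a, 1, b, 0; d, b, 1, c; 0, 0, c, 1] :
      Matrix (Fin 4) (Fin 4) ℝ).PosDef) : a ^ 2 < 1 ∧ b ^ 2 + c ^ 2 < 1 := by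
  constructor
  · have := h.dotProduct_mulVec_pos (x := ![1, -a, 0, 0]) fun h => by simpa using congrFun h 0
    rw [star_trivial, quadraticForm_eq] at this
    simpa using this
  · have := h.dotProduct_mulVec_pos (x := ![0, -b, 1, -c]) fun h => by simpa using congrFun h 2
    rw [star_trivial, quadraticForm_eq] at this
    simp at this
    linarith

theorem inv_zero_two_eq_zero_iff {a b c d : ℝ}
    (h : (!![1, a, d, 0; a, 1, b, 0; d, b, 1, c; 0, 0, c, 1] :
      Matrix (Fin 4) (Fin 4) ℝ).PosDef) :
    (!![1, a, d, 0; a, 1, b, 0; d, b, 1, c; 0, 0, c, 1] :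
      Matrix (Fin 4) (Fin 4) ℝ)⁻¹ 0 2 = 0 ↔ d = a * b := by
  have hdet := h.det_pos.ne'
  rw [Matrix.inv_def, Matrix.smul_apply, Ring.inverse_eq_inv', smul_eq_mul, mul_eq_zero,
    or_iff_right (inv_ne_zero hdet), Matrix.adjugate_fin_succ_eq_det_submatrix, Matrix.det_fin_three]
  simp [Fin.succAbove]
  constructor <;> intro h <;> linarith


/-- The concrete double Markovian correlation model on `N = {1,2,3,4}` with
`G = K₄` minus the edge `{1,3}` and `H` the graph with edges
`{1,2}, {1,3}, {2,3}, {3,4}` (here `1,2,3,4` are represented by `0,1,2,3 : Fin 4`):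
`M₁(G,H)` consists exactly of the matrices
`[[1, a, ab, 0], [a, 1, b, 0], [ab, b, 1, c], [0, 0, c, 1]]`
with `a ∈ (-1,1)` and `b² + c² < 1`. -/
theorem doubleMarkov_example_parametrized :
    {S : Matrix (Fin 4) (Fin 4) ℝ | S.PosDef ∧ (∀ i, S i i = 1) ∧
        (∀ i j : Fin 4, i ≠ j →
          ¬ (SimpleGraph.fromEdgeSet
              {s((0 : Fin 4), (1 : Fin 4)), s((0 : Fin 4), (3 : Fin 4)),
               s((1 : Fin 4), (2 : Fin 4)), s((1 : Fin 4), (3 : Fin 4)),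
               s((2 : Fin 4), (3 : Fin 4))}).Adj i j → S⁻¹ i j = 0) ∧
        (∀ i j : Fin 4, i ≠ j →
          ¬ (SimpleGraph.fromEdgeSet
              {s((0 : Fin 4), (1 : Fin 4)), s((0 : Fin 4), (2 : Fin 4)),
               s((1 : Fin 4), (2 : Fin 4)), s((2 : Fin 4), (3 : Fin 4))}).Adj i j →
          S i j = 0)} =
      {S : Matrix (Fin 4) (Fin 4) ℝ | ∃ a b c : ℝ,
        -1 < a ∧ a < 1 ∧ b ^ 2 + c ^ 2 < 1 ∧
        S = !![1, a, a * b, 0; a, 1, b, 0; a * b, b, 1, c; 0, 0, c, 1]} := by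
  ext S
  simp only [Set.mem_ofPred_eq]
  constructor
  · rintro ⟨hS, hdiag, hinv, hzero⟩
    have hsymm (i j) : S j i = S i j := by simpa using hS.isHermitian.apply i j
    have h03 : S 0 3 = 0 := hzero 0 3 (by decide) (by simp)
    have h13 : S 1 3 = 0 := hzero 1 3 (by decide) (by simp)
    have h02 : S⁻¹ 0 2 = 0 := hinv 0 2 (by decide) (by simp)
    have hform : S = !![1, S 0 1, S 0 2, 0; S 0 1, 1, S 1 2, 0;
        S 0 2, S 1 2, 1, S 2 3; 0, 0, S 2 3, 1] := by
      ext i j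
      fin_cases i <;> fin_cases j <;>
        simp [hdiag, h03, h13, hsymm 0 1, hsymm 0 2, hsymm 0 3, hsymm 1 2, hsymm 1 3, hsymm 2 3]
    generalize S 0 1 = a at hform
    generalize S 0 2 = d at hform
    generalize S 1 2 = b at hform
    generalize S 2 3 = c at hform
    subst hform
    obtain ⟨ha, hbc⟩ := sq_lt_one_of_posDef hS
    obtain rfl := (inv_zero_two_eq_zero_iff hS).1 h02
    obtain ⟨ha₁, ha₂⟩ := abs_lt.1 ((sq_lt_one_iff_abs_lt_one a).1 ha)
    exact ⟨a, b, c, ha₁, ha₂, hbc, rfl⟩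
  · rintro ⟨a, b, c, ha₁, ha₂, hbc, rfl⟩
    have hS := posDef_of_lt ((sq_lt_one_iff_abs_lt_one a).2 (abs_lt.2 ⟨ha₁, ha₂⟩)) hbc
    have h02 := (inv_zero_two_eq_zero_iff hS).2 rfl
    have h20 := hS.inv.isHermitian.apply 2 0
    rw [h02, star_zero] at h20
    refine ⟨hS, fun i => by fin_cases i <;> rfl, fun i j hij hadj => ?_, fun i j hij hadj => ?_⟩
    · have : i = 0 ∧ j = 2 ∨ i = 2 ∧ j = 0 := by
        fin_cases i <;> fin_cases j <;> simp at hij hadj ⊢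
      rcases this with ⟨rfl, rfl⟩ | ⟨rfl, rfl⟩
      exacts [h02, h20.symm]
    · fin_cases i <;> fin_cases j <;> simp at hij hadj ⊢
end

section
/- For a real symmetric positive definite n×n matrix Σ with unit diagonal (Σ_{ii} = 1 for all i), define Φ(Σ) := D·Σ⁻¹·D, where D is the diagonal matrix with D_{ii} = ((Σ⁻¹)_{ii})^{−1/2}. Then: (a) Φ(Σ) is again symmetric positive definite with unit diagonal; (b) Φ(Φ(Σ)) = Σ; and (c) for any simple graphs G, H on N = {1,…,n}, Σ ∈ M₁(G,H) if and only if Φ(Σ) ∈ M₁(H,G). -/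
/-- The involution on correlation matrices: invert and renormalize to unit diagonal,
`Φ(Σ) = D Σ⁻¹ D` where `D = diag(((Σ⁻¹)_{ii})^{-1/2})`. -/
noncomputable def corrInv {n : ℕ} (A : Matrix (Fin n) (Fin n) ℝ) :
    Matrix (Fin n) (Fin n) ℝ :=
  Matrix.diagonal (fun i => (Real.sqrt (A⁻¹ i i))⁻¹) * A⁻¹ *
    Matrix.diagonal (fun i => (Real.sqrt (A⁻¹ i i))⁻¹)

theorem corrInv_apply {n : ℕ} (A : Matrix (Fin n) (Fin n) ℝ) (i j : Fin n) :
    corrInv A i j = (Real.sqrt (A⁻¹ i i))⁻¹ * A⁻¹ i j * (Real.sqrt (A⁻¹ j j))⁻¹ := by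
  simp [corrInv, Matrix.mul_diagonal, Matrix.diagonal_mul]

theorem sqrt_inv_diag_pos {n : ℕ} {A : Matrix (Fin n) (Fin n) ℝ} (hA : A.PosDef) (i : Fin n) :
    0 < Real.sqrt (A⁻¹ i i) :=
  Real.sqrt_pos.2 hA.inv.diag_pos

theorem corrInv_posDef {n : ℕ} {A : Matrix (Fin n) (Fin n) ℝ} (hA : A.PosDef) :
    (corrInv A).PosDef := by
  have hD : IsUnit (Matrix.diagonal fun i => (Real.sqrt (A⁻¹ i i))⁻¹) :=
    (Matrix.PosDef.diagonal fun i => inv_pos.2 (sqrt_inv_diag_pos hA i)).isUnit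
  have h := (Matrix.IsUnit.posDef_star_right_conjugate_iff hD).2 hA.inv
  simpa [corrInv, Matrix.star_eq_conjTranspose, Matrix.diagonal_conjTranspose] using h

theorem corrInv_apply_self {n : ℕ} {A : Matrix (Fin n) (Fin n) ℝ} (hA : A.PosDef) (i : Fin n) :
    corrInv A i i = 1 := by
  have h := sqrt_inv_diag_pos hA i
  rw [corrInv_apply]
  field_simp
  exact (Real.sq_sqrt hA.inv.diag_pos.le).symm

theorem corrInv_inv_apply {n : ℕ} {A : Matrix (Fin n) (Fin n) ℝ} (hA : A.PosDef) (i j : Fin n) :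
    (corrInv A)⁻¹ i j = Real.sqrt (A⁻¹ i i) * A i j * Real.sqrt (A⁻¹ j j) := by
  have hdet : IsUnit A.det := (Matrix.isUnit_iff_isUnit_det _).1 hA.isUnit
  have hinv : (Matrix.diagonal fun i => (Real.sqrt (A⁻¹ i i))⁻¹)⁻¹ =
      Matrix.diagonal fun i => Real.sqrt (A⁻¹ i i) := by
    refine Matrix.inv_eq_right_inv ?_
    rw [Matrix.diagonal_mul_diagonal, ← Matrix.diagonal_one]
    congr 1
    funext k
    exact inv_mul_cancel₀ (sqrt_inv_diag_pos hA k).ne'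
  rw [corrInv, Matrix.mul_inv_rev, Matrix.mul_inv_rev, hinv,
    Matrix.nonsing_inv_nonsing_inv _ hdet, Matrix.diagonal_mul, Matrix.mul_diagonal, mul_assoc]

theorem corrInv_corrInv {n : ℕ} {A : Matrix (Fin n) (Fin n) ℝ} (hA : A.PosDef)
    (hdiag : ∀ i, A i i = 1) : corrInv (corrInv A) = A := by
  have hsqrt (i : Fin n) : Real.sqrt ((corrInv A)⁻¹ i i) = Real.sqrt (A⁻¹ i i) := by
    rw [corrInv_inv_apply hA, hdiag, mul_one, Real.mul_self_sqrt hA.inv.diag_pos.le]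
  ext i j
  have hi := (sqrt_inv_diag_pos hA i).ne'
  have hj := (sqrt_inv_diag_pos hA j).ne'
  rw [corrInv_apply, hsqrt, hsqrt, corrInv_inv_apply hA]
  field_simp

/-- For a positive definite matrix `Σ` with unit diagonal: (a) `Φ(Σ)` is again
positive definite with unit diagonal, (b) `Φ` is an involution, and (c) `Σ` belongs
to the correlation model `M₁(G,H)` if and only if `Φ(Σ)` belongs to `M₁(H,G)`. -/
theorem corrInv_involution_maps_models {n : ℕ} (G H : SimpleGraph (Fin n))
    (S : Matrix (Fin n) (Fin n) ℝ) (hpd : S.PosDef) (hdiag : ∀ i, S i i = 1) :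
    ((corrInv S).PosDef ∧ ∀ i, corrInv S i i = 1) ∧
      corrInv (corrInv S) = S ∧
      (((∀ i j : Fin n, i ≠ j → ¬ G.Adj i j → S⁻¹ i j = 0) ∧
          (∀ i j : Fin n, i ≠ j → ¬ H.Adj i j → S i j = 0)) ↔
        ((∀ i j : Fin n, i ≠ j → ¬ H.Adj i j → (corrInv S)⁻¹ i j = 0) ∧
          (∀ i j : Fin n, i ≠ j → ¬ G.Adj i j → corrInv S i j = 0))) := by
  have hz (i : Fin n) : Real.sqrt (S⁻¹ i i) ≠ 0 := (sqrt_inv_diag_pos hpd i).ne'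
  have hinv (i j : Fin n) : (corrInv S)⁻¹ i j = 0 ↔ S i j = 0 := by
    simp [corrInv_inv_apply hpd, hz]
  have hcorr (i j : Fin n) : corrInv S i j = 0 ↔ S⁻¹ i j = 0 := by
    simp only [corrInv_apply, mul_eq_zero, inv_eq_zero, hz, false_or, or_false]
  refine ⟨⟨corrInv_posDef hpd, corrInv_apply_self hpd⟩, corrInv_corrInv hpd hdiag, ?_⟩
  simp only [hinv, hcorr]
  exact and_comm
end
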